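/- arXiv:2103.05565 — 5 statements merged into one kernel-verified Lean document; each statement's English description precedes it below -/
import Mathlib

section
/- (Colorful KKM theorem) Let n ≥ 1 and for each i ∈ {1,…,n} let A₁ⁱ, …, Aₙⁱ be open subsets of the standard simplex Δ^{n-1} ⊆ ℝⁿ such that for every i ∈ {1,…,n} and every nonempty subset I ⊆ {1,…,n}, the face conv{e_j : j ∈ I} of Δ^{n-1} is contained in ⋃_{j ∈ I} A_jⁱ. Then there exists a permutation π of {1,…,n} such that ⋂_{i=1}^{n} A_{i}^{π(i)} ≠ ∅. -/
open Set

namespace KKM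

def Dom {I V α : Type*} [LinearOrder α] (u : I → V → α) (S : Finset V) : Prop :=
  ∀ y, ∃ i, ∀ x ∈ S, u i y ≤ u i x

section scarf
variable {I V α : Type*} [Fintype I] [DecidableEq I] [Fintype V] [DecidableEq V] [LinearOrder α]

/-- characterization of one side -/
lemma half (u : I → V → α) (hu : ∀ i, Function.Injective (u i)) (D : Finset V) (hD : Dom u D)
    (m : I → V) (hmD : ∀ i, m i ∈ D) (hm : ∀ i, ∀ x ∈ D, u i (m i) ≤ u i x)
    (i j : I) (hij : i ≠ j) (hmij : m i = m j)
    (hinj : ∀ k l, k ≠ i → l ≠ i → m k = m l → k = l)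
    (e : V) (he : ∀ l, l ≠ i → u l (m l) < u l e) :
    ∃ z, z ∉ D ∧ Dom u (insert z D) ∧ (∀ l, l ≠ i → u l (m l) < u l z) ∧
      ∀ z', z' ∉ D → Dom u (insert z' D) → u i z' < u i (m i) → z' = z := by
  classical
  have hsurj : ∀ x ∈ D, ∃ l, m l = x := by
    intro x hx
    obtain ⟨l, hl⟩ := hD x
    exact ⟨l, hu l (le_antisymm (hm l x hx) (hl _ (hmD l)))⟩
  obtain ⟨z, hz, hzmax⟩ := Finset.exists_max_image
    (Finset.univ.filter fun y => ∀ l, l ≠ i → u l (m l) < u l y) (u i) ⟨e, by simpa using he⟩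
  simp only [Finset.mem_filter, Finset.mem_univ, true_and] at hz hzmax
  refine ⟨z, ?_, ?_, hz, ?_⟩
  · intro hzD
    obtain ⟨l, rfl⟩ := hsurj z hzD
    by_cases hl : l = i
    · subst hl
      have := hz j hij.symm
      rw [hmij] at this
      exact lt_irrefl _ this
    · exact lt_irrefl _ (hz l hl)
  · intro y
    by_cases hy : ∀ l, l ≠ i → u l (m l) < u l y
    · refine ⟨i, ?_⟩
      intro x hx
      rcases Finset.mem_insert.1 hx with rfl | hx
      · exact hzmax y hy
      · obtain ⟨l, hl⟩ := hD y
        by_cases hli : l = i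
        · subst hli; exact hl x hx
        · exact absurd (hl _ (hmD l)) (not_le.2 (hy l hli))
    · push Not at hy
      obtain ⟨l, hl, hly⟩ := hy
      refine ⟨l, ?_⟩
      intro x hx
      rcases Finset.mem_insert.1 hx with rfl | hx
      · exact hly.trans (hz l hl).le
      · exact hly.trans (hm l x hx)
  · intro z' hz'D hz' hz'i
    have hM : ∀ l, l ≠ i → u l (m l) < u l z' := by
      intro l hl
      obtain ⟨l', hl'⟩ := hz' (m l)
      have h1 : m l' = m l := hu l' (le_antisymm (hm l' _ (hmD l))
        (hl' _ (Finset.mem_insert_of_mem (hmD l'))))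
      have h2 := hl' z' (Finset.mem_insert_self _ _)
      have h3 : l' ≠ i := by
        rintro rfl
        rw [← h1] at h2
        exact absurd h2 (not_le.2 hz'i)
      have h4 := hinj l' l h3 hl h1
      subst h4
      refine lt_of_le_of_ne h2 fun h => hz'D ?_
      rw [← hu _ h]; exact hmD _
    refine hu i (le_antisymm (hzmax z' hM) ?_)
    obtain ⟨l, hl⟩ := hz' z
    by_cases hli : l = i
    · subst hli; exact hl _ (Finset.mem_insert_self _ _)
    · exact absurd (hl _ (Finset.mem_insert_of_mem (hmD l))) (not_le.2 (hz l hli))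

open Classical in
lemma door_even (u : I → V → α) (hu : ∀ i, Function.Injective (u i)) (e : I → V)
    (h2 : ∀ l i, i ≠ l → ∀ v, v ∉ Set.range e → u l v < u l (e i))
    (D : Finset V) (hcard : D.card + 1 = Fintype.card I) (t : V) (ht : t ∈ D)
    (hte : t ∉ Set.range e) :
    Even (Finset.univ.filter fun z => z ∉ D ∧ Dom u (insert z D)).card := by
  by_cases hD : Dom u D
  swap
  · rw [Finset.filter_false_of_mem]
    · simp
    · rintro z - ⟨-, hz⟩
      apply hD
      intro y
      obtain ⟨i, hi⟩ := hz y
      exact ⟨i, fun x hx => hi x (Finset.mem_insert_of_mem hx)⟩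
  have := fun i => Finset.exists_min_image D (u i) ⟨t, ht⟩
  choose m hmD hm using this
  have hsurj : ∀ x ∈ D, ∃ l, m l = x := by
    intro x hx
    obtain ⟨l, hl⟩ := hD x
    exact ⟨l, hu l (le_antisymm (hm l x hx) (hl _ (hmD l)))⟩
  obtain ⟨i, -, j, -, hij, hmij⟩ := Finset.exists_ne_map_eq_of_card_lt_of_maps_to
    (s := Finset.univ) (t := D) (f := m) (by rw [Finset.card_univ]; omega) (fun a _ => hmD a)
  have hinj : ∀ i j, i ≠ j → m i = m j → ∀ k l, k ≠ i → l ≠ i → m k = m l → k = l := by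
    intro i j hij hmij
    have him : (Finset.univ.erase i).image m = D := by
      ext x
      simp only [Finset.mem_image, Finset.mem_erase, Finset.mem_univ, and_true]
      constructor
      · rintro ⟨l, -, rfl⟩; exact hmD l
      · intro hx
        obtain ⟨l, rfl⟩ := hsurj x hx
        by_cases hl : l = i
        · exact ⟨j, hij.symm, by rw [hl, hmij]⟩
        · exact ⟨l, hl, rfl⟩
    have : Set.InjOn m (Finset.univ.erase i : Finset I) := by
      apply Finset.injOn_of_card_image_eq
      rw [him, Finset.card_erase_of_mem (Finset.mem_univ _), Finset.card_univ]; omega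
    intro k l hk hl h
    exact this (by simpa using hk) (by simpa using hl) h
  have hee : ∀ i l, l ≠ i → u l (m l) < u l (e i) := fun i l hl =>
    (hm l t ht).trans_lt (h2 l i hl.symm t hte)
  obtain ⟨z₁, a1, b1, c1, d1⟩ := half u hu D hD m hmD hm i j hij hmij (hinj i j hij hmij) (e i) (hee i)
  obtain ⟨z₂, a2, b2, c2, d2⟩ := half u hu D hD m hmD hm j i hij.symm hmij.symm
    (hinj j i hij.symm hmij.symm) (e j) (hee j)
  have hne : z₁ ≠ z₂ := by
    rintro rfl
    obtain ⟨l, hl⟩ := hD z₁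
    by_cases hli : l = i
    · exact absurd (hl _ (hmD l)) (not_le.2 (c2 l (hli ▸ hij)))
    · exact absurd (hl _ (hmD l)) (not_le.2 (c1 l hli))
  have : (Finset.univ.filter fun z => z ∉ D ∧ Dom u (insert z D)) = {z₁, z₂} := by
    ext z
    simp only [Finset.mem_filter, Finset.mem_univ, true_and, Finset.mem_insert, Finset.mem_singleton]
    constructor
    · rintro ⟨hzD, hz⟩
      obtain ⟨k, hk⟩ := hz z
      have hk' : u k z < u k (m k) := by
        refine lt_of_le_of_ne (hk _ (Finset.mem_insert_of_mem (hmD k))) fun h => hzD ?_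
        rw [hu _ h]; exact hmD _
      obtain ⟨l, hl⟩ := hz (m k)
      have e1 : m l = m k := hu l (le_antisymm (hm l _ (hmD k))
        (hl _ (Finset.mem_insert_of_mem (hmD l))))
      have e2 := hl z (Finset.mem_insert_self _ _)
      have e3 : l ≠ k := by
        rintro rfl
        exact absurd e2 (not_le.2 hk')
      by_cases hki : k = i
      · subst hki; exact Or.inl (d1 z hzD hz hk')
      by_cases hkj : k = j
      · subst hkj; exact Or.inr (d2 z hzD hz hk')
      exfalso
      by_cases hli : l = i
      · exact e3 (hinj j i hij.symm hmij.symm l k (hli ▸ hij) hkj e1)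
      · exact e3 (hinj i j hij hmij l k hli hki e1)
    · rintro (rfl | rfl)
      · exact ⟨a1, b1⟩
      · exact ⟨a2, b2⟩
  rw [this, Finset.card_pair hne]
  exact even_two

open Classical in
lemma door_bdry (u : I → V → α) (hu : ∀ i, Function.Injective (u i)) (e : I → V)
    (h1 : ∀ i v, u i (e i) ≤ u i v)
    (h2 : ∀ l i, i ≠ l → ∀ v, v ∉ Set.range e → u l v < u l (e i))
    (i₀ : I)
    (t : V) (hte : t ∉ Set.range e) :
    (Finset.univ.filter fun z => z ∉ (Finset.univ.erase i₀).image e ∧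
      Dom u (insert z ((Finset.univ.erase i₀).image e))).card = 1 := by
  obtain ⟨z, hz, hzmax⟩ := Finset.exists_max_image
    (Finset.univ.filter fun y => y ∉ Set.range e) (u i₀) ⟨t, by simpa using hte⟩
  simp only [Finset.mem_filter, Finset.mem_univ, true_and] at hz hzmax
  have hnot : ∀ l v, v ∉ Set.range e → ¬ u l v ≤ u l (e l) := by
    intro l v hv h
    exact hv ⟨l, hu l (le_antisymm (h1 l v) h)⟩
  rw [Finset.card_eq_one]
  refine ⟨z, ?_⟩
  ext w
  simp only [Finset.mem_filter, Finset.mem_univ, true_and, Finset.mem_singleton]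
  constructor
  · rintro ⟨hw, hdom⟩
    have key : ∀ y, y ∉ Set.range e → u i₀ y ≤ u i₀ w := by
      intro y hy
      obtain ⟨l, hl⟩ := hdom y
      by_cases hli : l = i₀
      · subst hli; exact hl _ (Finset.mem_insert_self _ _)
      · exact absurd (hl (e l) (Finset.mem_insert_of_mem
          (Finset.mem_image_of_mem _ (by simpa using hli)))) (hnot l y hy)
    have hwe : w ∉ Set.range e := by
      rintro ⟨k, rfl⟩
      by_cases hk : k = i₀
      · subst hk; exact hnot _ z hz (key z hz)
      · exact hw (Finset.mem_image_of_mem _ (by simpa using hk))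
    exact hu i₀ (le_antisymm (hzmax w hwe) (key z hz))
  · rintro rfl
    refine ⟨?_, ?_⟩
    · intro h
      obtain ⟨k, -, rfl⟩ := Finset.mem_image.1 h
      exact hz ⟨k, rfl⟩
    · intro y
      by_cases hy : y ∈ Set.range e
      · obtain ⟨k, rfl⟩ := hy
        exact ⟨k, fun x _ => h1 k x⟩
      · refine ⟨i₀, fun x hx => ?_⟩
        rcases Finset.mem_insert.1 hx with rfl | hx
        · exact hzmax y hy
        · obtain ⟨k, hk, rfl⟩ := Finset.mem_image.1 hx
          exact (h2 i₀ k (by simpa using hk) y hy).le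

open Classical in
lemma room_even (c : V → I) (i₀ : I) (S : Finset V) (hS : S.card = Fintype.card I)
    (hc : S.image c ≠ Finset.univ) :
    Even (Finset.univ.filter fun z => z ∈ S ∧ (S.erase z).image c = Finset.univ.erase i₀).card := by
  by_cases hne : ∃ z, z ∈ S ∧ (S.erase z).image c = Finset.univ.erase i₀
  swap
  · rw [Finset.filter_false_of_mem]
    · simp
    · intro z _ h; exact hne ⟨z, h⟩
  obtain ⟨z, hzS, hz⟩ := hne
  have hinj : Set.InjOn c (S.erase z : Finset V) := by
    apply Finset.injOn_of_card_image_eq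
    rw [hz, Finset.card_erase_of_mem (Finset.mem_univ _), Finset.card_univ,
      Finset.card_erase_of_mem hzS, hS]
  have hcz : c z ≠ i₀ := by
    intro h
    apply hc
    rw [← Finset.insert_erase hzS, Finset.image_insert, hz, h, Finset.insert_erase (Finset.mem_univ _)]
  have hm : ∀ k, k ≠ i₀ ↔ ∃ a, (a ≠ z ∧ a ∈ S) ∧ c a = k := by
    intro k
    have := Finset.ext_iff.1 hz k
    simpa using this.symm
  obtain ⟨z', ⟨hz'z, hz'S⟩, hcz'⟩ := (hm _).1 hcz
  have : (Finset.univ.filter fun z => z ∈ S ∧ (S.erase z).image c = Finset.univ.erase i₀) = {z, z'} := by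
    ext w
    simp only [Finset.mem_filter, Finset.mem_univ, true_and, Finset.mem_insert, Finset.mem_singleton]
    constructor
    · rintro ⟨hwS, hw⟩
      by_contra! hcon
      have : c w ∈ (S.erase w).image c := by
        rw [hw]; simp only [Finset.mem_erase, Finset.mem_univ, and_true]
        exact (hm _).2 ⟨w, ⟨hcon.1, hwS⟩, rfl⟩
      simp only [Finset.mem_image, Finset.mem_erase] at this
      obtain ⟨b, ⟨hbw, hbS⟩, hb⟩ := this
      by_cases hbz : b = z
      · subst hbz
        exact hcon.2 (hinj (by simp [hcon.1, hwS]) (by simp [hz'z, hz'S]) (by rw [hcz', hb]))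
      · exact hbw (hinj (by simp [hbz, hbS]) (by simp [hcon.1, hwS]) hb)
    · rintro (rfl | rfl)
      · exact ⟨hzS, hz⟩
      · refine ⟨hz'S, ?_⟩
        ext k
        simp only [Finset.mem_image, Finset.mem_erase, Finset.mem_univ, and_true]
        constructor
        · rintro ⟨a, ⟨_, haS⟩, rfl⟩
          by_cases haz : a = z
          · rw [haz]; exact hcz
          · exact (hm _).2 ⟨a, ⟨haz, haS⟩, rfl⟩
        · intro hk
          obtain ⟨b, ⟨hbz, hbS⟩, rfl⟩ := (hm k).1 hk
          by_cases hb : b = w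
          · subst hb; exact ⟨z, ⟨hz'z.symm, hzS⟩, hcz'.symm⟩
          · exact ⟨b, ⟨hb, hbS⟩, rfl⟩
  rw [this, Finset.card_pair hz'z.symm]
  exact even_two

open Classical in
theorem scarf [Nonempty I] (u : I → V → α) (hu : ∀ i, Function.Injective (u i)) (e : I → V)
    (h1 : ∀ i v, u i (e i) ≤ u i v)
    (h2 : ∀ l i, i ≠ l → ∀ v, v ∉ Set.range e → u l v < u l (e i))
    (t : V) (hte : t ∉ Set.range e) (c : V → I) (hc : ∀ i, c (e i) = i) :
    ∃ S : Finset V, Dom u S ∧ S.image c = Finset.univ := by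
  by_contra! hcon
  have he : Function.Injective e := fun a b h => by rw [← hc a, ← hc b, h]
  obtain ⟨i₀⟩ := ‹Nonempty I›
  let P : Finset (Finset V × V) := Finset.univ.filter fun p =>
    (p.1.card + 1 = Fintype.card I ∧ p.1.image c = Finset.univ.erase i₀) ∧
      (p.2 ∉ p.1 ∧ Dom u (insert p.2 p.1))
  let Q : Finset (Finset V × V) := Finset.univ.filter fun p =>
    (p.1.card = Fintype.card I ∧ Dom u p.1) ∧
      (p.2 ∈ p.1 ∧ (p.1.erase p.2).image c = Finset.univ.erase i₀)
  have hPQ : P.card = Q.card := by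
    refine Finset.card_nbij' (fun p => (insert p.2 p.1, p.2)) (fun p => (p.1.erase p.2, p.2)) ?_ ?_ ?_ ?_
    · rintro ⟨D, z⟩ h
      simp only [P, Q, Finset.coe_filter, Finset.mem_univ, true_and, Set.mem_ofPred_eq] at h ⊢
      obtain ⟨⟨a, b⟩, c', d⟩ := h
      refine ⟨⟨by rw [Finset.card_insert_of_notMem c', a], d⟩, Finset.mem_insert_self _ _, ?_⟩
      rw [Finset.erase_insert c', b]
    · rintro ⟨D, z⟩ h
      simp only [P, Q, Finset.coe_filter, Finset.mem_univ, true_and, Set.mem_ofPred_eq] at h ⊢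
      obtain ⟨⟨a, b⟩, c', d⟩ := h
      refine ⟨⟨by rw [Finset.card_erase_add_one c', a], d⟩, Finset.notMem_erase _ _, ?_⟩
      rw [Finset.insert_erase c']; exact b
    · rintro ⟨D, z⟩ h
      simp only [P, Finset.coe_filter, Finset.mem_univ, true_and, Set.mem_ofPred_eq] at h
      simp [Finset.erase_insert h.2.1]
    · rintro ⟨D, z⟩ h
      simp only [Q, Finset.coe_filter, Finset.mem_univ, true_and, Set.mem_ofPred_eq] at h
      simp [Finset.insert_erase h.2.1]
  have fib : ∀ (A : Finset V → Prop) (B : Finset V → V → Prop) [DecidablePred A] [∀ D, DecidablePred (B D)],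
      (Finset.univ.filter fun p : Finset V × V => A p.1 ∧ B p.1 p.2).card
        = ∑ D ∈ Finset.univ.filter A, (Finset.univ.filter fun z => B D z).card := by
    intro A B _ _
    simp only [Finset.card_filter, Fintype.sum_prod_type, Finset.sum_filter]
    refine Finset.sum_congr rfl fun D _ => ?_
    by_cases h : A D <;> simp [h]
  have hQ : Even Q.card := by
    have hf := (fib (fun S => S.card = Fintype.card I ∧ Dom u S)
      (fun S z => z ∈ S ∧ (S.erase z).image c = Finset.univ.erase i₀))
    have hf' : Q.card = _ := Eq.trans (by simp only [Q]) hf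
    rw [hf']
    refine Finset.even_sum _ fun S hS => ?_
    simp only [Finset.mem_filter, Finset.mem_univ, true_and] at hS
    exact room_even c i₀ S hS.1 (hcon S hS.2)
  have hP : Odd P.card := by
    have hf := (fib (fun D => D.card + 1 = Fintype.card I ∧ D.image c = Finset.univ.erase i₀)
      (fun D z => z ∉ D ∧ Dom u (insert z D)))
    have hf' : P.card = _ := Eq.trans (by simp only [P]) hf
    rw [hf']
    have hcm : (Finset.univ.erase i₀).image e ∈ Finset.univ.filter (fun D : Finset V =>
        D.card + 1 = Fintype.card I ∧ D.image c = Finset.univ.erase i₀) := by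
      simp only [Finset.mem_filter, Finset.mem_univ, true_and]
      constructor
      · rw [Finset.card_image_of_injective _ he, Finset.card_erase_add_one (Finset.mem_univ _),
          Finset.card_univ]
      · rw [Finset.image_image]
        have : c ∘ e = id := funext hc
        rw [this, Finset.image_id]
    rw [← Finset.add_sum_erase _ _ hcm, door_bdry u hu e h1 h2 i₀ t hte]
    refine Even.one_add (Finset.even_sum _ fun D hD => ?_)
    simp only [Finset.mem_filter, Finset.mem_univ, true_and, Finset.mem_erase] at hD
    obtain ⟨hne, hcard, him⟩ := hD
    have : ∃ t ∈ D, t ∉ Set.range e := by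
      by_contra! hall
      apply hne
      ext v
      simp only [Finset.mem_image, Finset.mem_erase, Finset.mem_univ, and_true]
      constructor
      · intro hv
        obtain ⟨k, rfl⟩ := hall v hv
        have : c (e k) ∈ D.image c := Finset.mem_image_of_mem _ hv
        rw [him, hc] at this
        exact ⟨k, by simpa using this, rfl⟩
      · rintro ⟨k, hk, rfl⟩
        have : k ∈ D.image c := by rw [him]; simpa using hk
        obtain ⟨v, hv, hvk⟩ := Finset.mem_image.1 this
        obtain ⟨k', rfl⟩ := hall v hv
        rw [hc] at hvk
        rwa [← hvk]
    obtain ⟨t', ht', ht'e⟩ := this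
    exact door_even u hu e h2 D hcard t' ht' ht'e
  rw [hPQ] at hP
  exact (Nat.not_even_iff_odd.2 hP) hQ

end scarf
open Classical in
theorem grid (n N : ℕ) (hn : 1 ≤ n) (c : (Fin n → ℕ) → Fin n) :
    ∃ x₀ : Fin n → ℕ, ∑ k, x₀ k = N ∧ ∀ i,
      (∃ x : Fin n → ℕ, ∑ k, x k = N ∧ c x = i ∧ ∀ k, x k ≤ x₀ k + n ∧ x₀ k ≤ x k + n) ∨
        x₀ i ≤ n := by
  have : Nonempty (Fin n) := ⟨⟨0, hn⟩⟩
  let T := {x : Fin n → ℕ // x ∈ Finset.piAntidiag Finset.univ N}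
  have hT : ∀ x : Fin n → ℕ, x ∈ Finset.piAntidiag Finset.univ N ↔ ∑ k, x k = N := by
    intro x; simp [Finset.mem_piAntidiag]
  let V := Fin n ⊕ T
  let _ : Fintype T := inferInstanceAs (Fintype {x : Fin n → ℕ // x ∈ Finset.piAntidiag Finset.univ N})
  let _ : Fintype V := inferInstanceAs (Fintype (Fin n ⊕ T))
  let w : Fin n → V → ℕ := fun l v => Sum.elim (fun i => if i = l then 0 else N + 2)
    (fun x : T => x.1 l + 1) v
  let g := Fintype.equivFin V
  let u : Fin n → V → ℕ ×ₗ Fin (Fintype.card V) := fun l v => toLex (w l v, g v)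
  have ule : ∀ l a b, u l a ≤ u l b → w l a ≤ w l b := by
    intro l a b h
    rcases Prod.Lex.toLex_le_toLex.1 h with h | h
    · exact h.le
    · exact h.1.le
  have ult : ∀ l a b, w l a < w l b → u l a < u l b := by
    intro l a b h
    exact Prod.Lex.toLex_lt_toLex.2 (Or.inl h)
  have hxle : ∀ (x : Fin n → ℕ), ∑ k, x k = N → ∀ l, x l ≤ N := by
    intro x hx l
    rw [← hx]; exact Finset.single_le_sum (f := x) (fun _ _ => Nat.zero_le _) (Finset.mem_univ l)
  have t0 : T := ⟨Pi.single ⟨0, hn⟩ N, by rw [hT]; simp⟩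
  obtain ⟨S, hdom, hcol⟩ := scarf u
    (by
      intro i a b h
      have : (w i a, g a) = (w i b, g b) := toLex.injective h
      exact g.injective (Prod.ext_iff.1 this).2)
    (Sum.inl : Fin n → V)
    (by
      rintro i (k | x)
      · by_cases h : k = i
        · rw [h]
        · exact (ult _ _ _ (by simp [w, h])).le
      · exact (ult _ _ _ (by simp [w])).le)
    (by
      rintro l i hil (k | x) hv
      · exact absurd ⟨k, rfl⟩ hv
      · apply ult
        have := hxle x.1 ((hT _).1 x.2) l
        simp only [w, Sum.elim_inl, Sum.elim_inr, if_neg hil]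
        omega)
    (Sum.inr t0) (by simp) (Sum.elim id fun x : T => c x.1) (by simp)
  -- C = indices with slack not in S
  have hCy : ∀ y : T, ∃ i, Sum.inl i ∉ S ∧ ∀ x : T, Sum.inr x ∈ S → y.1 i ≤ x.1 i := by
    intro y
    obtain ⟨i, hi⟩ := hdom (Sum.inr y)
    refine ⟨i, ?_, ?_⟩
    · intro h
      have := ule _ _ _ (hi _ h)
      simp [w] at this
    · intro x hx
      have := ule _ _ _ (hi _ hx)
      simpa [w] using this
  have hCc : ∀ i, Sum.inl i ∉ S → ∃ x : T, Sum.inr x ∈ S ∧ c x.1 = i := by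
    intro i hi
    have : i ∈ S.image (Sum.elim id fun x : T => c x.1) := by rw [hcol]; simp
    obtain ⟨v, hv, hvi⟩ := Finset.mem_image.1 this
    rcases v with k | x
    · simp only [Sum.elim_inl, id] at hvi
      subst hvi; exact absurd hv hi
    · exact ⟨x, hv, hvi⟩
  obtain ⟨i₁, hi₁, -⟩ := hCy t0
  obtain ⟨x₀, hx₀S, -⟩ := hCc i₁ hi₁
  have hmin : ∀ i, ∃ μ : ℕ, (∀ x : T, Sum.inr x ∈ S → μ ≤ x.1 i) ∧ ∃ x : T, Sum.inr x ∈ S ∧ x.1 i = μ := by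
    intro i
    obtain ⟨x, hx, hxm⟩ := Finset.exists_min_image (Finset.univ.filter fun x : T => Sum.inr x ∈ S)
      (fun x => x.1 i) ⟨x₀, by simpa using hx₀S⟩
    simp only [Finset.mem_filter, Finset.mem_univ, true_and] at hx hxm
    exact ⟨x.1 i, hxm, x, hx, rfl⟩
  choose μ hμ hμ' using hmin
  let C : Finset (Fin n) := Finset.univ.filter fun i => Sum.inl i ∉ S
  have hi₁C : i₁ ∈ C := by simpa [C] using hi₁
  have hsum : N + 1 ≤ ∑ i ∈ C, (μ i + 1) := by
    by_contra! hlt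
    let y : Fin n → ℕ := fun i => (if i ∈ C then μ i + 1 else 0) +
      Pi.single (M := fun _ => ℕ) i₁ (N - ∑ i ∈ C, (μ i + 1)) i
    have hy : ∑ k, y k = N := by
      simp only [y, Finset.sum_add_distrib, Finset.sum_ite_mem, Finset.univ_inter,
        Finset.sum_pi_single']
      simp only [Finset.sum_add_distrib, Finset.mem_univ, if_true] at hlt ⊢
      omega
    obtain ⟨i, hi, hiy⟩ := hCy ⟨y, (hT y).2 hy⟩
    obtain ⟨x, hx, hxi⟩ := hμ' i
    have := hiy x hx
    rw [hxi] at this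
    have hiC : i ∈ C := by simpa [C] using hi
    simp only [y, if_pos hiC] at this
    omega
  have hsum' : N + 1 ≤ ∑ i ∈ C, μ i + n := by
    rw [Finset.sum_add_distrib] at hsum
    have : C.card ≤ n := by simpa using Finset.card_le_univ C
    simp at hsum; omega
  have hup : ∀ x : T, Sum.inr x ∈ S → ∀ i, x.1 i ≤ (if i ∈ C then μ i else 0) + n := by
    intro x hx i
    have h1 : ∑ k, x.1 k = N := (hT _).1 x.2
    have h2 : ∑ k, (if k ∈ C then μ k else 0) = ∑ k ∈ C, μ k := by
      simp [Finset.sum_ite_mem]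
    have h3 : ∀ k, (if k ∈ C then μ k else 0) ≤ x.1 k := by
      intro k; split_ifs
      · exact hμ k x hx
      · exact Nat.zero_le _
    have h4 := Finset.add_sum_erase Finset.univ x.1 (Finset.mem_univ i)
    have h5 := Finset.add_sum_erase Finset.univ (fun k => if k ∈ C then μ k else 0) (Finset.mem_univ i)
    have h6 := Finset.sum_le_sum (s := Finset.univ.erase i) (fun k _ => h3 k)
    omega
  have hlo : ∀ x : T, Sum.inr x ∈ S → ∀ i, (if i ∈ C then μ i else 0) ≤ x.1 i := by
    intro x hx i; split_ifs
    · exact hμ i x hx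
    · exact Nat.zero_le _
  refine ⟨x₀.1, (hT _).1 x₀.2, fun i => ?_⟩
  by_cases hi : i ∈ C
  · left
    obtain ⟨x, hx, hxc⟩ := hCc i (by simpa [C] using hi)
    refine ⟨x.1, (hT _).1 x.2, hxc, fun k => ?_⟩
    have a1 := hup x hx k
    have a2 := hup x₀ hx₀S k
    have a3 := hlo x hx k
    have a4 := hlo x₀ hx₀S k
    omega
  · right
    have := hup x₀ hx₀S i
    simpa [hi] using this

theorem brouwer (n : ℕ) (hn : 1 ≤ n) (G : (Fin n → ℝ) → (Fin n → ℝ))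
    (hG : ContinuousOn G (stdSimplex ℝ (Fin n)))
    (hmap : ∀ x ∈ stdSimplex ℝ (Fin n), G x ∈ stdSimplex ℝ (Fin n)) :
    ∃ x ∈ stdSimplex ℝ (Fin n), G x = x := by
  classical
  have hcomp := isCompact_stdSimplex ℝ (Fin n)
  have hne : (stdSimplex ℝ (Fin n)).Nonempty := ⟨_, single_mem_stdSimplex ℝ (⟨0, hn⟩ : Fin n)⟩
  have approx : ∀ ε > 0, ∃ x ∈ stdSimplex ℝ (Fin n), ∀ i, x i - G x i ≤ ε := by
    intro ε hε
    obtain ⟨δ, hδ, hunif⟩ := Metric.uniformContinuousOn_iff.1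
      (hcomp.uniformContinuousOn_of_continuous hG) (ε / 2) (by positivity)
    obtain ⟨N, hN⟩ := exists_nat_gt (n / (min δ (ε / 2)))
    have hmin : 0 < min δ (ε / 2) := lt_min hδ (by positivity)
    have hNpos : (0 : ℝ) < N := lt_of_le_of_lt (by positivity) hN
    have hnN : (n : ℝ) / N < min δ (ε / 2) := by
      rw [div_lt_iff₀ hmin] at hN
      rw [div_lt_iff₀ hNpos]; linarith
    have hnN1 := hnN.trans_le (min_le_left _ _)
    have hnN2 := hnN.trans_le (min_le_right _ _)
    let q : (Fin n → ℕ) → (Fin n → ℝ) := fun x k => (x k : ℝ) / N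
    have hq : ∀ x : Fin n → ℕ, ∑ k, x k = N → q x ∈ stdSimplex ℝ (Fin n) := by
      intro x hx
      refine ⟨fun k => by positivity, ?_⟩
      simp only [q]
      rw [← Finset.sum_div, ← Nat.cast_sum, hx, div_self hNpos.ne']
    have hlab : ∀ x : Fin n → ℕ, ∃ i, ∑ k, x k = N → q x i ≤ G (q x) i := by
      intro x
      by_cases hx : ∑ k, x k = N
      · by_contra! hcon
        have h1 := (hq x hx).2
        have h2 := (hmap _ (hq x hx)).2
        have := Finset.sum_lt_sum_of_nonempty (s := (Finset.univ : Finset (Fin n)))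
          ⟨⟨0, hn⟩, Finset.mem_univ _⟩ (fun i _ => (hcon i).2)
        linarith
      · exact ⟨⟨0, hn⟩, fun h => absurd h hx⟩
    choose c hc using hlab
    obtain ⟨x₀, hx₀, hx⟩ := grid n N hn c
    refine ⟨q x₀, hq x₀ hx₀, fun i => ?_⟩
    rcases hx i with ⟨x, hxs, hci, hclose⟩ | hsmall
    · have hd : ∀ k, |q x k - q x₀ k| ≤ n / N := by
        intro k
        obtain ⟨a, b⟩ := hclose k
        have a' : (x k : ℝ) ≤ x₀ k + n := by exact_mod_cast a
        have b' : (x₀ k : ℝ) ≤ x k + n := by exact_mod_cast b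
        simp only [q]
        rw [← sub_div, abs_div, abs_of_pos hNpos]
        gcongr
        rw [abs_le]; constructor <;> linarith
      have hdist : dist (q x) (q x₀) < δ := by
        rw [dist_pi_lt_iff hδ]
        intro k; rw [Real.dist_eq]; exact (hd k).trans_lt hnN1
      have h1 := hunif _ (hq x hxs) _ (hq x₀ hx₀) hdist
      have h2 := (dist_le_pi_dist _ _ i).trans_lt h1
      rw [Real.dist_eq] at h2
      have h3 := hc x hxs
      rw [hci] at h3
      have h4 := hd i
      rw [abs_le] at h4
      rw [abs_lt] at h2
      linarith [h4.1, h2.2]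
    · have h1 := (hmap _ (hq x₀ hx₀)).1 i
      have h2 : q x₀ i ≤ n / N := by
        simp only [q]; gcongr
      linarith
  have hGi : ∀ i, ContinuousOn (fun x => G x i) (stdSimplex ℝ (Fin n)) := fun i =>
    (continuous_apply i).comp_continuousOn hG
  obtain ⟨p, hp, hpmin⟩ := hcomp.exists_isMinOn hne (f := fun x => ∑ i, max 0 (x i - G x i))
    (by
      refine continuousOn_finsetSum _ fun i _ => ?_
      exact ContinuousOn.sup continuousOn_const ((continuous_apply i).continuousOn.sub (hGi i)))
  have hle : ∀ ε > 0, ∑ i, max 0 (p i - G p i) ≤ 0 + ε := by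
    intro ε hε
    have hn' : (0 : ℝ) < n := by exact_mod_cast hn
    obtain ⟨x, hx, hxe⟩ := approx (ε / n) (by positivity)
    have h1 : ∑ i, max 0 (p i - G p i) ≤ ∑ i, max 0 (x i - G x i) := hpmin hx
    have h2 : ∑ i, max 0 (x i - G x i) ≤ ∑ i : Fin n, ε / n :=
      Finset.sum_le_sum fun i _ => max_le (by positivity) (hxe i)
    have h3 : ∑ i : Fin n, ε / n = ε := by
      simp; field_simp
    linarith
  have h0 := le_of_forall_pos_le_add hle
  have hz : ∀ i, p i ≤ G p i := by
    intro i
    have h1 := Finset.single_le_sum (f := fun i => max 0 (p i - G p i))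
      (fun i _ => le_max_left _ _) (Finset.mem_univ i)
    have h2 := le_max_right 0 (p i - G p i)
    linarith
  refine ⟨p, hp, ?_⟩
  have hs : ∑ i, p i = ∑ i, G p i := by rw [hp.2, (hmap p hp).2]
  have := (Finset.sum_eq_sum_iff_of_le (fun i _ => hz i)).1 hs
  ext i; exact (this i (Finset.mem_univ i)).symm

theorem hit (n : ℕ) (hn : 1 ≤ n) (H : (Fin n → ℝ) → (Fin n → ℝ))
    (hH : ContinuousOn H (stdSimplex ℝ (Fin n)))
    (hz : ∀ x ∈ stdSimplex ℝ (Fin n), ∀ j, x j = 0 → H x j = 0)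
    (hs : ∀ x ∈ stdSimplex ℝ (Fin n), ∑ j, H x j = n) :
    ∃ x ∈ stdSimplex ℝ (Fin n), ∀ j, H x j = 1 := by
  classical
  let r : (Fin n → ℝ) → Fin n → ℝ := fun x j => max 0 (1 - H x j)
  have hr0 : ∀ x j, 0 ≤ r x j := fun x j => le_max_left _ _
  have hr : ∀ j, ContinuousOn (fun x => r x j) (stdSimplex ℝ (Fin n)) := fun j =>
    ContinuousOn.sup continuousOn_const (continuousOn_const.sub ((continuous_apply j).comp_continuousOn hH))
  have hS0 : ∀ x, 0 ≤ ∑ k, r x k := fun x => Finset.sum_nonneg fun k _ => hr0 x k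
  obtain ⟨x, hx, hfix⟩ := brouwer n hn (fun x j => (x j + r x j) / (1 + ∑ k, r x k))
    (by
      refine continuousOn_pi.2 fun j => ?_
      refine ((continuous_apply j).continuousOn.add (hr j)).div
        (continuousOn_const.add (continuousOn_finsetSum _ fun k _ => hr k)) ?_
      intro x _
      have := hS0 x
      positivity)
    (by
      intro x hx
      have := hS0 x
      refine ⟨fun j => div_nonneg (add_nonneg (hx.1 j) (hr0 x j)) (by positivity), ?_⟩
      rw [← Finset.sum_div, Finset.sum_add_distrib, hx.2, div_self (by positivity)])
  have hfix' : ∀ j, r x j = x j * ∑ k, r x k := by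
    intro j
    have h := congrFun hfix j
    have := hS0 x
    rw [div_eq_iff (by positivity)] at h
    linarith
  have hge : ∀ j, 1 ≤ H x j := by
    by_contra! hcon
    obtain ⟨j₀, hj₀⟩ := hcon
    have hpos : 0 < ∑ k, r x k := by
      refine Finset.sum_pos' (fun k _ => hr0 x k) ⟨j₀, Finset.mem_univ _, ?_⟩
      exact lt_max_of_lt_right (by linarith)
    have hlt : ∀ j, H x j < 1 := by
      intro j
      rcases (hx.1 j).eq_or_lt with h | h
      · rw [hz x hx j h.symm]; norm_num
      · have h1 : 0 < r x j := by rw [hfix']; positivity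
        rcases lt_max_iff.1 h1 with h2 | h2
        · exact absurd h2 (lt_irrefl _)
        · linarith
    have := Finset.sum_lt_sum_of_nonempty (s := (Finset.univ : Finset (Fin n)))
      ⟨⟨0, hn⟩, Finset.mem_univ _⟩ (fun i _ => hlt i)
    rw [hs x hx] at this
    simp at this
  refine ⟨x, hx, fun j => ?_⟩
  have hsum : ∑ j : Fin n, (1 : ℝ) = ∑ j, H x j := by rw [hs x hx]; simp
  exact ((Finset.sum_eq_sum_iff_of_le (fun i _ => hge i)).1 hsum j (Finset.mem_univ j)).symm

end KKM

/-- The colorful KKM theorem. -/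
theorem stmt_7 (n : ℕ) (hn : 1 ≤ n) (A : Fin n → Fin n → Set (Fin n → ℝ))
    (hopen : ∀ i j, ∃ U : Set (Fin n → ℝ), IsOpen U ∧ A i j = U ∩ stdSimplex ℝ (Fin n))
    (hcover : ∀ i : Fin n, ∀ I : Set (Fin n), I.Nonempty →
      convexHull ℝ {x : Fin n → ℝ | ∃ j ∈ I, x = Pi.single j 1} ⊆ ⋃ j ∈ I, A i j) :
    ∃ π : Equiv.Perm (Fin n), (⋂ i, A (π i) i).Nonempty := by
  classical
  choose U hU hA using hopen
  let B : Fin n → Fin n → Set (Fin n → ℝ) := fun i j => U i j ∩ {x | 0 < x j}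
  have hB : ∀ i j, IsOpen (B i j) := fun i j =>
    (hU i j).inter (isOpen_lt continuous_const (continuous_apply j))
  have hBne : ∀ i j, ((B i j)ᶜ).Nonempty := fun i j => ⟨0, by simp [B]⟩
  let d : Fin n → Fin n → (Fin n → ℝ) → ℝ := fun i j x => Metric.infDist x (B i j)ᶜ
  have hd0 : ∀ i j x, 0 ≤ d i j x := fun i j x => Metric.infDist_nonneg
  have hdpos : ∀ i j x, 0 < d i j x ↔ x ∈ B i j := by
    intro i j x
    rw [← (hB i j).isClosed_compl.notMem_iff_infDist_pos (hBne i j)]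
    simp
  have hdc : ∀ i j, Continuous (d i j) := fun i j => Metric.continuous_infDist_pt _
  have hcov : ∀ i, ∀ x ∈ stdSimplex ℝ (Fin n), ∃ j, x ∈ B i j := by
    intro i x hx
    have hsupp : ({j | 0 < x j} : Set (Fin n)).Nonempty := by
      by_contra hne
      rw [Set.not_nonempty_iff_eq_empty] at hne
      have : ∀ j, x j ≤ 0 := fun j => by
        by_contra! h
        have : j ∈ ({j | 0 < x j} : Set (Fin n)) := h
        rw [hne] at this; exact this
      have h1 := hx.2
      have := Finset.sum_nonpos (s := Finset.univ) (fun j _ => this j)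
      linarith
    have hmem : x ∈ convexHull ℝ {y : Fin n → ℝ | ∃ j ∈ ({j | 0 < x j} : Set (Fin n)), y = Pi.single j 1} := by
      have hxe : x = ∑ j ∈ Finset.univ.filter (fun j => 0 < x j), x j • (Pi.single j 1 : Fin n → ℝ) := by
        rw [Finset.sum_filter_of_ne]
        · ext k
          simp [Finset.sum_apply, Pi.single_apply]
        · intro j _ h
          refine lt_of_le_of_ne (hx.1 j) fun h0 => h ?_
          rw [← h0, zero_smul]
      rw [hxe]
      refine (convex_convexHull ℝ _).sum_mem (fun j _ => hx.1 j) ?_ ?_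
      · rw [Finset.sum_filter_of_ne, hx.2]
        intro j _ h
        exact lt_of_le_of_ne (hx.1 j) (Ne.symm h)
      · intro j hj
        apply subset_convexHull
        refine ⟨j, ?_, rfl⟩
        rw [← hxe]
        simpa using hj
    have := hcover i _ hsupp hmem
    simp only [Set.mem_iUnion] at this
    obtain ⟨j, hj, hxA⟩ := this
    rw [hA] at hxA
    exact ⟨j, hxA.1, hj⟩
  have hsp : ∀ i, ∀ x ∈ stdSimplex ℝ (Fin n), 0 < ∑ j, d i j x := by
    intro i x hx
    obtain ⟨j, hj⟩ := hcov i x hx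
    exact Finset.sum_pos' (fun k _ => hd0 i k x) ⟨j, Finset.mem_univ _, (hdpos i j x).2 hj⟩
  obtain ⟨x, hx, hx1⟩ := KKM.hit n hn (fun x j => ∑ i, d i j x / ∑ k, d i k x)
    (by
      refine continuousOn_pi.2 fun j => continuousOn_finsetSum _ fun i _ => ?_
      exact (hdc i j).continuousOn.div (continuous_finsetSum _ fun k _ => hdc i k).continuousOn
        fun x hx => (hsp i x hx).ne')
    (by
      intro x hx j hj
      refine Finset.sum_eq_zero fun i _ => ?_
      have : d i j x = 0 := by
        refine le_antisymm (not_lt.1 fun h => ?_) (hd0 i j x)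
        have h2 := ((hdpos i j x).1 h).2
        have h3 : 0 < x j := h2
        linarith
      rw [this, zero_div])
    (by
      intro x hx
      rw [Finset.sum_comm]
      have : ∀ i, ∑ j, d i j x / ∑ k, d i k x = 1 := fun i => by
        rw [← Finset.sum_div, div_self (hsp i x hx).ne']
      simp [this])
  have hM : (Matrix.of fun i j => d i j x / ∑ k, d i k x) ∈ doublyStochastic ℝ (Fin n) := by
    rw [mem_doublyStochastic_iff_sum]
    refine ⟨fun i j => div_nonneg (hd0 i j x) (hsp i x hx).le, fun i => ?_, fun j => hx1 j⟩
    simp only [Matrix.of_apply]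
    rw [← Finset.sum_div, div_self (hsp i x hx).ne']
  obtain ⟨w, hw0, hw1, hwM⟩ := exists_eq_sum_perm_of_mem_doublyStochastic hM
  obtain ⟨σ, -, hσ⟩ : ∃ σ ∈ Finset.univ, 0 < w σ := by
    apply Finset.exists_lt_of_sum_lt (f := fun _ => (0 : ℝ))
    rw [hw1]; simp
  have hmem : ∀ i, x ∈ A i (σ i) := by
    intro i
    have h := congrFun (congrFun hwM i) (σ i)
    simp only [Matrix.sum_apply, Matrix.smul_apply, Matrix.of_apply, smul_eq_mul] at h
    have hpos : 0 < ∑ τ, w τ * (Equiv.Perm.permMatrix ℝ τ) i (σ i) := by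
      refine Finset.sum_pos' (fun τ _ => mul_nonneg (hw0 τ) ?_) ⟨σ, Finset.mem_univ _, ?_⟩
      · rw [Equiv.Perm.permMatrix, PEquiv.toMatrix_apply]
        split_ifs <;> norm_num
      · rw [Equiv.Perm.permMatrix, PEquiv.toMatrix_apply]
        simpa using hσ
    rw [h] at hpos
    have hdp : 0 < d i (σ i) x := by
      by_contra hcon
      have : d i (σ i) x = 0 := le_antisymm (not_lt.1 hcon) (hd0 _ _ _)
      rw [this, zero_div] at hpos
      exact lt_irrefl _ hpos
    rw [hA]
    exact ⟨((hdpos _ _ _).1 hdp).1, hx⟩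
  refine ⟨σ.symm, x, ?_⟩
  rw [Set.mem_iInter]
  intro j
  have := hmem (σ.symm j)
  rwa [Equiv.apply_symm_apply] at this
end

section
/- Let S be a nonempty connected set in ℝ² and let ℓ be a line in ℝ². If ℓ intersects conv(S), then ℓ intersects S. -/
open Set

/-- The Euclidean plane ℝ². -/
abbrev Plane := EuclideanSpace ℝ (Fin 2)

/-- A line in the plane: a one-dimensional affine subspace of ℝ². -/
def IsLine (l : Set Plane) : Prop :=
  ∃ p v : Plane, v ≠ 0 ∧ l = {x | ∃ t : ℝ, x = p + t • v}

/-- A triple of sets `A, B, C` is tight if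
`conv(A ∪ B) ∩ conv(A ∪ C) ∩ conv(B ∪ C) ≠ ∅`. -/
def Tight (A B C : Set Plane) : Prop :=
  (convexHull ℝ (A ∪ B) ∩ convexHull ℝ (A ∪ C) ∩ convexHull ℝ (B ∪ C)).Nonempty

/-- A family `F` of sets in the plane is pierced by `k` lines if there are `k` lines
such that every member of `F` intersects their union. -/
def PiercedByLines (F : Set (Set Plane)) (k : ℕ) : Prop :=
  ∃ L : Fin k → Set Plane, (∀ i, IsLine (L i)) ∧ ∀ S ∈ F, (S ∩ ⋃ i, L i).Nonempty

theorem stmt_8 (S l : Set Plane) (hne : S.Nonempty) (hconn : IsConnected S)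
    (hl : IsLine l) (h : (l ∩ convexHull ℝ S).Nonempty) :
    (l ∩ S).Nonempty := by
  obtain ⟨p, v, hv, rfl⟩ := hl
  obtain ⟨q, ⟨t, rfl⟩, hq⟩ := h
  let f : Plane →ₗ[ℝ] ℝ :=
    { toFun := fun x => v 1 * x 0 - v 0 * x 1
      map_add' := by intro x y; simp only [PiLp.add_apply]; ring
      map_smul' := by
        intro c x
        simp only [PiLp.smul_apply, smul_eq_mul, RingHom.id_apply]; ring }
  have hf : ∀ x, f x = v 1 * x 0 - v 0 * x 1 := fun x => rfl
  have hcont : Continuous f := f.continuous_of_finiteDimensional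
  have hc : Convex ℝ (f '' S) :=
    ((hconn.image f hcont.continuousOn).isPreconnected.ordConnected).convex
  have hsub : convexHull ℝ S ⊆ f ⁻¹' (f '' S) :=
    convexHull_min (subset_preimage_image f S) (hc.linear_preimage f)
  obtain ⟨s, hs, hfs⟩ := hsub hq
  rw [hf, hf] at hfs
  simp only [PiLp.add_apply, PiLp.smul_apply, smul_eq_mul] at hfs
  refine ⟨s, ?_, hs⟩
  by_cases h0 : v 0 = 0
  · have h1 : v 1 ≠ 0 := by
      intro h1
      apply hv
      ext i
      fin_cases i <;> simp [h0, h1]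
    refine ⟨(s 1 - p 1) / v 1, ?_⟩
    ext i
    fin_cases i
    · simp [h0] at hfs ⊢
      exact hfs.resolve_right h1
    · simp; field_simp; ring
  · refine ⟨(s 0 - p 0) / v 0, ?_⟩
    ext i
    fin_cases i
    · simp; field_simp; ring
    · simp; field_simp; linarith
end

section
/- Let F be a family of nonempty compact sets in ℝ² whose union is bounded, and let k be a positive integer. If every finite subfamily of F is pierced by k lines, then F is pierced by k lines. -/
open Set

lemma normLine (R : ℝ) (hR : 0 < R) (l : Set Plane) (hl : IsLine l) :
    ∃ q : Plane × Plane, q ∈ Metric.closedBall (0 : Plane) R ×ˢ Metric.sphere (0 : Plane) 1 ∧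
      ∀ y ∈ l, y ∈ Metric.closedBall (0 : Plane) R →
        ∃ t : Icc (-(2 * R)) (2 * R), y = q.1 + (t : ℝ) • q.2 := by
  obtain ⟨p, v, hv, rfl⟩ := hl
  have hn : ‖v‖ ≠ 0 := norm_ne_zero_iff.mpr hv
  have hu : ‖(‖v‖⁻¹ • v)‖ = 1 := by
    rw [norm_smul, norm_inv, norm_norm, inv_mul_cancel₀ hn]
  by_cases h : ∃ x, x ∈ {x | ∃ t : ℝ, x = p + t • v} ∧ x ∈ Metric.closedBall (0 : Plane) R
  · obtain ⟨x, ⟨s, hs⟩, hxR⟩ := h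
    refine ⟨(x, ‖v‖⁻¹ • v), ⟨hxR, by simpa using hu⟩, ?_⟩
    rintro y ⟨t, ht⟩ hyR
    have hy : y = x + ((t - s) * ‖v‖) • (‖v‖⁻¹ • v) := by
      rw [smul_smul, mul_assoc, mul_inv_cancel₀ hn, mul_one, hs, ht, sub_smul]
      abel
    have hle : |(t - s) * ‖v‖| ≤ 2 * R := by
      have h1 : ‖y - x‖ = |(t - s) * ‖v‖| := by
        conv_lhs => rw [hy]
        rw [add_sub_cancel_left, norm_smul, hu, mul_one, Real.norm_eq_abs]
      rw [← h1]
      have h2 := norm_sub_le y x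
      rw [mem_closedBall_zero_iff] at hxR hyR
      linarith
    exact ⟨⟨_, abs_le.mp hle⟩, hy⟩
  · refine ⟨(0, ‖v‖⁻¹ • v), ⟨by simpa using hR.le, by simpa using hu⟩, ?_⟩
    intro y hy hyR
    exact absurd ⟨y, hy, hyR⟩ h

lemma closedHit (R : ℝ) (S : Set Plane) (hS : IsClosed S) :
    IsClosed {q : Plane × Plane | ∃ t : Icc (-(2 * R)) (2 * R), q.1 + (t : ℝ) • q.2 ∈ S} := by
  have h : IsClosed {z : Icc (-(2 * R)) (2 * R) × (Plane × Plane) |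
      z.2.1 + (z.1 : ℝ) • z.2.2 ∈ S} := hS.preimage (by fun_prop)
  have := isClosedMap_snd_of_compactSpace _ h
  convert this using 1
  ext q
  simp

theorem stmt_11 (F : Set (Set Plane)) (k : ℕ) (hk : 0 < k)
    (hne : ∀ S ∈ F, S.Nonempty)
    (hcpt : ∀ S ∈ F, IsCompact S)
    (hbdd : Bornology.IsBounded (⋃₀ F))
    (hfin : ∀ G : Finset (Set Plane), ↑G ⊆ F → PiercedByLines ↑G k) :
    PiercedByLines F k := by
  classical
  obtain ⟨R, hR, hFR⟩ := hbdd.subset_closedBall_lt 0 (0 : Plane)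
  have hA : IsCompact (Set.pi univ (fun _ : Fin k =>
      Metric.closedBall (0 : Plane) R ×ˢ Metric.sphere (0 : Plane) 1)) :=
    isCompact_univ_pi fun _ => (isCompact_closedBall _ _).prod (isCompact_sphere _ _)
  obtain ⟨q, hqA, hq⟩ := hA.inter_iInter_nonempty
    (fun S : F => ⋃ i : Fin k, (fun q : Fin k → Plane × Plane => q i) ⁻¹'
      {q : Plane × Plane | ∃ t : Icc (-(2 * R)) (2 * R), q.1 + (t : ℝ) • q.2 ∈ S.1})
    (fun S => isClosed_iUnion_of_finite fun i =>
      (closedHit R S.1 (hcpt S.1 S.2).isClosed).preimage (continuous_apply i)) (by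
    intro u
    obtain ⟨L, hL, hLS⟩ := hfin (u.image Subtype.val) (by
      intro S hS
      simp only [Finset.coe_image, Set.mem_image] at hS
      obtain ⟨T, _, rfl⟩ := hS
      exact T.2)
    choose q hq1 hq2 using fun i => normLine R hR (L i) (hL i)
    refine ⟨q, fun i _ => hq1 i, ?_⟩
    simp only [mem_iInter]
    intro S hS
    obtain ⟨y, hyS, hyL⟩ := hLS S.1 (by
      simp only [Finset.coe_image]
      exact ⟨S, hS, rfl⟩)
    obtain ⟨i, hi⟩ := mem_iUnion.mp hyL
    obtain ⟨t, ht⟩ := hq2 i y hi (hFR ⟨S.1, S.2, hyS⟩)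
    exact mem_iUnion.mpr ⟨i, t, ht ▸ hyS⟩)
  refine ⟨fun i => {x | ∃ t : ℝ, x = (q i).1 + t • (q i).2}, fun i => ⟨_, _, ?_, rfl⟩, ?_⟩
  · intro h0
    have h := (hqA i (mem_univ i)).2
    rw [h0] at h
    simp at h
  · intro S hS
    obtain ⟨i, t, ht⟩ := mem_iUnion.mp (mem_iInter.mp hq ⟨S, hS⟩)
    exact ⟨_, ht, mem_iUnion.mpr ⟨i, t, rfl⟩⟩
end

section
/- Let F₁, …, F₆ be finite families of nonempty compact connected sets in ℝ² such that for every choice of indices 1 ≤ i₁ < i₂ < i₃ ≤ 6 and every choice of sets A₁ ∈ F_{i₁}, A₂ ∈ F_{i₂}, A₃ ∈ F_{i₃}, the triple A₁, A₂, A₃ is tight. Let q be any point of ℝ² not contained in conv(⋃_{j=1}^{6} ⋃_{S ∈ F_j} S). Then there exists an index i ∈ {1,…,6} and three lines ℓ₁, ℓ₂, ℓ₃ in ℝ² such that every member of F_i intersects ℓ₁ ∪ ℓ₂ ∪ ℓ₃ and q lies on one of the lines ℓ₁, ℓ₂, ℓ₃. -/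
open Set

section
open Metric MeasureTheory

lemma det_poly {E : Type*} [NormedAddCommGroup E] [InnerProductSpace ℝ E] [FiniteDimensional ℝ E]
    (A : E →L[ℝ] E) : ∃ P : Polynomial ℝ, P.natDegree ≤ Module.finrank ℝ E ∧
      ∀ t : ℝ, P.eval t = (ContinuousLinearMap.id ℝ E + t • A).det := by
  let b := Module.finBasis ℝ E
  let M := LinearMap.toMatrix b b (A : E →ₗ[ℝ] E)
  refine ⟨Matrix.det ((Polynomial.X : Polynomial ℝ) • M.map Polynomial.C
    + (1 : Matrix _ _ ℝ).map Polynomial.C), ?_, ?_⟩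
  · simpa using Polynomial.natDegree_det_X_add_C_le M 1
  · intro t
    rw [ContinuousLinearMap.det, ← LinearMap.det_toMatrix b, ← Polynomial.coe_evalRingHom,
      RingHom.map_det]
    congr 1
    ext i j
    simp [M, Matrix.one_apply, LinearMap.toMatrix_apply, apply_ite, add_comm, Finsupp.single_apply, eq_comm]
    ring

lemma det_zero_of_range {E : Type*} [NormedAddCommGroup E] [InnerProductSpace ℝ E]
    [FiniteDimensional ℝ E] {A : E →ₗ[ℝ] E} (h : LinearMap.range A ≠ ⊤) : LinearMap.det A = 0 := by
  by_contra hc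
  exact h (LinearMap.range_eq_top.2 (LinearEquiv.ofIsUnitDet (f := A) (v := Module.finBasis ℝ E) (v' := Module.finBasis ℝ E)
    (by rw [LinearMap.det_toMatrix]; exact isUnit_iff_ne_zero.2 hc)).surjective)

lemma det_pos_small {E : Type*} [NormedAddCommGroup E] [InnerProductSpace ℝ E]
    [FiniteDimensional ℝ E] (A : E →L[ℝ] E) (t : ℝ) (ht : 0 ≤ t) (h : t * ‖A‖ < 1) :
    0 < (ContinuousLinearMap.id ℝ E + t • A).det := by
  obtain ⟨P, -, hP⟩ := det_poly A
  have hne : ∀ s ∈ Icc 0 t, P.eval s ≠ 0 := by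
    intro s hs h0
    rw [hP, ContinuousLinearMap.det] at h0
    have := LinearMap.bot_lt_ker_of_det_eq_zero h0
    obtain ⟨v, hv, hv0⟩ := (Submodule.ne_bot_iff _).1 this.ne'
    have hv' : v + s • A v = 0 := by simpa using hv
    have h1 : ‖v‖ = s * ‖A v‖ := by
      conv_lhs => rw [eq_neg_of_add_eq_zero_left hv', norm_neg, norm_smul, Real.norm_of_nonneg hs.1]
    have h2 := A.le_opNorm v
    have h3 : 0 < ‖v‖ := norm_pos_iff.2 hv0
    have h4 : s * ‖A v‖ ≤ t * (‖A‖ * ‖v‖) :=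
      mul_le_mul hs.2 h2 (norm_nonneg _) ht
    nlinarith
  rw [← hP]
  by_contra hcon
  push Not at hcon
  have h0 : P.eval 0 = 1 := by
    rw [hP]; simp [ContinuousLinearMap.det]
  have := intermediate_value_Icc' (f := fun s => P.eval s) ht P.continuous.continuousOn
  obtain ⟨s, hs, hs0⟩ := this ⟨hcon, by simp [h0]⟩
  exact hne s hs hs0

lemma no_retraction {E : Type*} [NormedAddCommGroup E] [InnerProductSpace ℝ E]
    [FiniteDimensional ℝ E] [MeasurableSpace E] [BorelSpace E] (r : E → E)
    (hr : ∀ x ∈ closedBall (0:E) 1, ContDiffAt ℝ 1 r x)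
    (h1 : ∀ x ∈ closedBall (0:E) 1, ‖r x‖ = 1)
    (h2 : ∀ x : E, ‖x‖ = 1 → r x = x) : False := by
  set g : E → E := fun x => r x - x with hg
  have hgd : ∀ x ∈ closedBall (0:E) 1, ContDiffAt ℝ 1 g x := fun x hx =>
    (hr x hx).sub contDiffAt_id
  have hgdiff : ∀ x ∈ closedBall (0:E) 1, DifferentiableAt ℝ g x := fun x hx =>
    (hgd x hx).differentiableAt (by norm_num)
  have hfc : ContinuousOn (fderiv ℝ g) (closedBall (0:E) 1) := fun x hx =>
    ((hgd x hx).fderiv_right (m := 0) (by norm_num)).continuousAt.continuousWithinAt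
  have hcb : IsCompact (closedBall (0:E) 1) := isCompact_closedBall 0 1
  obtain ⟨L, hL⟩ := hcb.exists_bound_of_continuousOn hfc
  have hL0 : 0 ≤ L := (norm_nonneg _).trans (hL 0 (by simp))
  have hlip : ∀ x ∈ closedBall (0:E) 1, ∀ y ∈ closedBall (0:E) 1, ‖g y - g x‖ ≤ L * ‖y - x‖ :=
    fun x hx y hy => (convex_closedBall (0:E) 1).norm_image_sub_le_of_norm_fderiv_le
      hgdiff hL hx hy
  set f : ℝ → E → E := fun t x => x + t • g x with hf
  set f' : ℝ → E → (E →L[ℝ] E) := fun t x => ContinuousLinearMap.id ℝ E + t • fderiv ℝ g x with hf'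
  have hfd : ∀ t, ∀ x ∈ closedBall (0:E) 1, HasFDerivAt (f t) (f' t x) x := fun t x hx =>
    (hasFDerivAt_id x).add ((hgdiff x hx).hasFDerivAt.const_smul t)
  have hfs : ∀ t, ∀ x ∈ closedBall (0:E) 1, HasStrictFDerivAt (f t) (f' t x) x := fun t x hx =>
    (hasStrictFDerivAt_id x).add (((hgd x hx).hasStrictFDerivAt (by norm_num)).const_smul t)
  have hbc : ball (0:E) 1 ⊆ closedBall 0 1 := ball_subset_closedBall
  set V : ℝ := (volume (ball (0:E) 1)).toReal with hV
  have hVpos : 0 < V := ENNReal.toReal_pos (measure_ball_pos _ _ one_pos).ne' measure_ball_lt_top.ne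
  -- small t
  have hdetpos : ∀ t, 0 ≤ t → t * L < 1 → ∀ x ∈ closedBall (0:E) 1, 0 < (f' t x).det := by
    intro t ht htL x hx
    exact det_pos_small _ t ht ((mul_le_mul_of_nonneg_left (hL x hx) ht).trans_lt htL)
  have hsmall : ∀ t, 0 ≤ t → t < 1 → t * L < 1 → ∫ x in ball (0:E) 1, (f' t x).det = V := by
    intro t ht ht1 htL
    have hinj : InjOn (f t) (closedBall 0 1) := by
      intro x hx y hy hxy
      have e : y - x = - (t • (g y - g x)) := by
        simp only [hf] at hxy
        rw [smul_sub]
        have h5 : y + t • g y - (x + t • g x) = 0 := by rw [← hxy, sub_self]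
        rw [eq_neg_iff_add_eq_zero, ← h5]; abel
      have := hlip x hx y hy
      have e2 : ‖y - x‖ = t * ‖g y - g x‖ := by
        conv_lhs => rw [e, norm_neg, norm_smul, Real.norm_of_nonneg ht]
      by_contra hne
      have : 0 < ‖y - x‖ := norm_pos_iff.2 (sub_ne_zero.2 (Ne.symm hne))
      nlinarith [mul_le_mul_of_nonneg_left (hlip x hx y hy) ht]
    have hmap : ∀ x ∈ ball (0:E) 1, f t x ∈ ball (0:E) 1 := by
      intro x hx
      have e : f t x = (1 - t) • x + t • r x := by simp only [hf, hg]; module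
      have hx' : ‖x‖ < 1 := by simpa using hx
      rw [mem_ball_zero_iff, e]
      calc _ ≤ ‖(1 - t) • x‖ + ‖t • r x‖ := norm_add_le _ _
        _ = (1 - t) * ‖x‖ + t * 1 := by
          rw [norm_smul, norm_smul, h1 x (hbc hx), Real.norm_of_nonneg ht,
            Real.norm_of_nonneg (by linarith)]
        _ < 1 := by nlinarith
    have hsph : ∀ x : E, ‖x‖ = 1 → f t x = x := by
      intro x hx; simp [hf, hg, h2 x hx]
    have hopen : IsOpen (f t '' ball 0 1) := by
      rw [isOpen_iff_mem_nhds]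
      rintro _ ⟨x, hx, rfl⟩
      have hd := (hdetpos t ht htL x (hbc hx)).ne'
      have hs := hfs t x (hbc hx)
      have hsurj : (f' t x).range = ⊤ := by
        by_contra hcon
        exact hd (det_zero_of_range hcon)
      rw [← hs.map_nhds_eq_of_surj hsurj]
      exact Filter.image_mem_map (isOpen_ball.mem_nhds hx)
    have himg : f t '' ball 0 1 = ball 0 1 := by
      apply Subset.antisymm
      · rintro _ ⟨x, hx, rfl⟩; exact hmap x hx
      · have hclosed : IsClosed (f t '' closedBall 0 1) := by
          refine (hcb.image_of_continuousOn fun x hx => ?_).isClosed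
          exact (hfd t x hx).continuousAt.continuousWithinAt
        refine (convex_ball (0:E) 1).isPreconnected.subset_of_closure_inter_subset hopen ?_ ?_
        · exact ⟨f t 0, hmap 0 (by simp), mem_image_of_mem _ (by simp)⟩
        · rintro y ⟨hy1, hy2⟩
          have : y ∈ f t '' closedBall 0 1 :=
            (closure_minimal (image_mono hbc) hclosed) hy1
          obtain ⟨x, hx, rfl⟩ := this
          rcases lt_or_eq_of_le (mem_closedBall_zero_iff.1 hx) with h | h
          · exact ⟨x, by simpa using h, rfl⟩
          · rw [hsph x h, mem_ball_zero_iff, h] at hy2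
            exact absurd hy2 (lt_irrefl _)
    have key := integral_image_eq_integral_abs_det_fderiv_smul (volume : Measure E)
      (measurableSet_ball : MeasurableSet (ball (0:E) 1))
      (fun x hx => (hfd t x (hbc hx)).hasFDerivWithinAt) (hinj.mono hbc) (fun _ => (1:ℝ))
    rw [himg] at key
    have e1 : ∫ x in ball (0:E) 1, (1:ℝ) = V := by simp [hV, Measure.real]
    rw [e1] at key
    rw [key]
    refine setIntegral_congr_fun measurableSet_ball fun x hx => ?_
    simp [abs_of_pos (hdetpos t ht htL x (hbc hx))]
  -- at t = 1
  have hone : ∀ x ∈ ball (0:E) 1, (f' 1 x).det = 0 := by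
    intro x hx
    have hd : HasFDerivAt r (f' 1 x) x := by
      have := hfd 1 x (hbc hx)
      have e : f 1 = r := by ext x; simp [hf, hg]
      rwa [e] at this
    have hin := hd.inner ℝ hd
    have hc : (fun y => inner ℝ (r y) (r y)) =ᶠ[nhds x] fun _ => (1:ℝ) := by
      filter_upwards [isOpen_ball.mem_nhds hx] with y hy
      rw [real_inner_self_eq_norm_sq, h1 y (hbc hy)]; norm_num
    have h0 := hin.unique ((hasFDerivAt_const (1:ℝ) x).congr_of_eventuallyEq hc)
    have h0' : ∀ v, inner ℝ (r x) (f' 1 x v) = 0 := by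
      intro v
      have := DFunLike.congr_fun h0 v
      simp [fderivInnerCLM_apply, real_inner_comm] at this
      simpa [real_inner_comm] using this
    refine det_zero_of_range fun htop => ?_
    obtain ⟨v, hv⟩ := LinearMap.range_eq_top.1 htop (r x)
    have h3 := h0' v
    change (f' 1 x) v = r x at hv
    rw [hv, real_inner_self_eq_norm_sq, h1 x (hbc hx)] at h3
    norm_num at h3
  -- interpolation
  set n := Module.finrank ℝ E
  set δ : ℝ := 1 / ((n + 2) * (L + 1)) with hδ
  have hδ0 : 0 < δ := by positivity
  have hnode : ∀ k ∈ Finset.range (n + 1), ∫ x in ball (0:E) 1, (f' (k * δ) x).det = V := by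
    intro k hk
    have hk' : (k:ℝ) < n + 2 := by
      have := Finset.mem_range.1 hk
      have : (k:ℝ) < ((n + 1 : ℕ) : ℝ) := by exact_mod_cast this
      push_cast at this; linarith
    have e : k * δ * (L + 1) < 1 := by
      rw [hδ]
      have : (k:ℝ) * (1 / ((n + 2) * (L + 1))) * (L + 1) = k / (n + 2) := by
        field_simp
      rw [this, div_lt_one (by positivity)]; exact hk'
    have e0 : 0 ≤ k * δ := by positivity
    refine hsmall _ e0 ?_ ?_ <;> nlinarith
  have hinj : Set.InjOn (fun k : ℕ => (k:ℝ) * δ) (Finset.range (n + 1)) := by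
    intro a _ b _ hab
    have := mul_right_cancel₀ hδ0.ne' hab
    exact_mod_cast this
  set c : ℕ → ℝ := fun k => (Lagrange.basis (Finset.range (n + 1)) (fun k : ℕ => (k:ℝ) * δ) k).eval 1
  have hlag : ∀ x, (f' 1 x).det = ∑ k ∈ Finset.range (n + 1), (f' (k * δ) x).det * c k := by
    intro x
    obtain ⟨P, hdeg, hP⟩ := det_poly (fderiv ℝ g x)
    have hd : P.degree < (Finset.range (n + 1)).card := by
      rw [Finset.card_range]
      exact (Polynomial.degree_le_natDegree).trans_lt (by exact_mod_cast Nat.lt_succ_of_le hdeg)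
    have := Lagrange.eq_interpolate hinj hd
    have h3 := congrArg (Polynomial.eval 1) this
    rw [Lagrange.interpolate_apply, Polynomial.eval_finsetSum] at h3
    simp only [Polynomial.eval_mul, Polynomial.eval_C, hP] at h3
    exact h3
  have hint : ∀ t, IntegrableOn (fun x => (f' t x).det) (ball (0:E) 1) := by
    intro t
    refine (ContinuousOn.integrableOn_compact hcb ?_).mono_set hbc
    exact ContinuousLinearMap.continuous_det.comp_continuousOn
      (continuousOn_const.add (hfc.const_smul t))
  have hsum : ∑ k ∈ Finset.range (n + 1), c k = 1 := by
    have := Lagrange.sum_basis hinj ⟨0, by simp⟩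
    have h3 := congrArg (Polynomial.eval 1) this
    rw [Polynomial.eval_finsetSum] at h3
    simpa using h3
  have hfin : ∫ x in ball (0:E) 1, (f' 1 x).det = V := by
    simp_rw [hlag]
    rw [integral_finsetSum _ (fun k _ => (hint _).mul_const _)]
    simp_rw [integral_mul_const]
    rw [Finset.sum_congr rfl fun k hk => by rw [hnode k hk], ← Finset.mul_sum, hsum, mul_one]
  rw [setIntegral_congr_fun measurableSet_ball hone] at hfin
  simp at hfin
  exact hVpos.ne hfin

lemma brouwer_C1 {E : Type*} [NormedAddCommGroup E] [InnerProductSpace ℝ E]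
    [FiniteDimensional ℝ E] [MeasurableSpace E] [BorelSpace E] (f : E → E)
    (hf : ContDiff ℝ 1 f) (hmap : ∀ x : E, ‖x‖ ≤ 1 → ‖f x‖ ≤ 1) : ∃ x : E, ‖x‖ ≤ 1 ∧ f x = x := by
  by_contra hcon
  push Not at hcon
  set u : E → E := fun x => x - f x with hu
  set a : E → ℝ := fun x => inner ℝ (u x) (u x) with ha
  set b : E → ℝ := fun x => inner ℝ x (u x) with hb
  set D : E → ℝ := fun x => b x ^ 2 + a x * (1 - inner ℝ x x) with hD
  have hu0 : ∀ x, ‖x‖ ≤ 1 → 0 < a x := by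
    intro x hx
    have : u x ≠ 0 := sub_ne_zero.2 (Ne.symm (hcon x hx))
    exact real_inner_self_pos.2 this
  have hbs : ∀ x, ‖x‖ = 1 → 0 < b x := by
    intro x hx
    have h1 : b x = 1 - inner ℝ x (f x) := by
      simp only [hb, hu, inner_sub_right, real_inner_self_eq_norm_sq, hx]; norm_num
    have h2 := hu0 x hx.le
    have h3 : a x = 1 - 2 * inner ℝ x (f x) + ‖f x‖ ^ 2 := by
      simp only [ha, hu, inner_sub_right, inner_sub_left, real_inner_self_eq_norm_sq, hx,
        real_inner_comm x (f x)]; ring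
    have h4 := hmap x hx.le
    have h5 := norm_nonneg (f x)
    nlinarith
  have hDpos : ∀ x, ‖x‖ ≤ 1 → 0 < D x := by
    intro x hx
    rcases lt_or_eq_of_le hx with h | h
    · have : 0 < 1 - inner ℝ x x := by
        rw [real_inner_self_eq_norm_sq]; nlinarith [norm_nonneg x]
      have := mul_pos (hu0 x hx) this
      simp only [hD]; nlinarith [sq_nonneg (b x)]
    · have := hbs x h
      simp only [hD, real_inner_self_eq_norm_sq, h]; nlinarith
  have hcu : ContDiff ℝ 1 u := contDiff_id.sub hf
  have hca : ContDiff ℝ 1 a := hcu.inner ℝ hcu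
  have hcb : ContDiff ℝ 1 b := contDiff_id.inner ℝ hcu
  have hcD : ContDiff ℝ 1 D :=
    (hcb.pow 2).add (hca.mul (contDiff_const.sub (contDiff_id.inner ℝ contDiff_id)))
  refine no_retraction (fun x => x + ((-b x + √(D x)) / a x) • u x) ?_ ?_ ?_
  · intro x hx
    have hx : ‖x‖ ≤ 1 := by simpa using hx
    exact contDiffAt_id.add (((hcb.contDiffAt.neg.add
      (hcD.contDiffAt.sqrt (hDpos x hx).ne')).div hca.contDiffAt (hu0 x hx).ne').smul
        hcu.contDiffAt)
  · intro x hx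
    have hx : ‖x‖ ≤ 1 := by simpa using hx
    set l := (-b x + √(D x)) / a x with hl
    have e1 : l * a x + b x = √(D x) := by
      rw [hl, div_mul_cancel₀ _ (hu0 x hx).ne']; ring
    have e2 : (l * a x + b x) ^ 2 = D x := by rw [e1, Real.sq_sqrt (hDpos x hx).le]
    have e3 : ‖x + l • u x‖ ^ 2 = inner ℝ x x + 2 * l * b x + l ^ 2 * a x := by
      rw [← real_inner_self_eq_norm_sq, inner_add_left, inner_add_right, inner_add_right,
        real_inner_smul_left, real_inner_smul_left, real_inner_smul_right, real_inner_smul_right,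
        real_inner_comm x (u x)]
      simp only [ha, hb]; ring
    have e4 : a x * (‖x + l • u x‖ ^ 2 - 1) = 0 := by
      rw [e3]; simp only [hD] at e2; linear_combination e2
    have e5 : ‖x + l • u x‖ ^ 2 = 1 := by
      rcases mul_eq_zero.1 e4 with h | h
      · exact absurd h (hu0 x hx).ne'
      · linarith
    exact (pow_eq_one_iff_of_nonneg (norm_nonneg _) two_ne_zero).1 e5
  · intro x hx
    have : D x = b x ^ 2 := by simp [hD, hx]
    simp [this, Real.sqrt_sq (hbs x hx).le]

lemma brouwer_ball {E : Type*} [NormedAddCommGroup E] [InnerProductSpace ℝ E]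
    [FiniteDimensional ℝ E] [MeasurableSpace E] [BorelSpace E] (f : E → E)
    (hf : Continuous f) (R : ℝ) (hR : 0 < R) (hmap : ∀ x : E, ‖f x‖ ≤ R) :
    ∃ x : E, f x = x := by
  -- rescale
  set h : E → E := fun x => R⁻¹ • f (R • x) with hh
  have hhc : Continuous h := by fun_prop
  have hhm : ∀ x, ‖h x‖ ≤ 1 := by
    intro x
    simp only [hh, norm_smul, norm_inv, Real.norm_of_nonneg hR.le]
    rw [inv_mul_le_iff₀ hR]; simpa using hmap (R • x)
  suffices ∃ x, h x = x by
    obtain ⟨x, hx⟩ := this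
    refine ⟨R • x, ?_⟩
    conv_rhs => rw [← hx]
    simp [hh, smul_smul, hR.ne']
  by_contra hcon
  push Not at hcon
  obtain ⟨x₀, hx₀, hmin⟩ := (isCompact_closedBall (0:E) 1).exists_isMinOn ⟨0, by simp⟩
    (f := fun x => ‖h x - x‖) (by fun_prop)
  set m := ‖h x₀ - x₀‖
  have hm : 0 < m := norm_pos_iff.2 (sub_ne_zero.2 (hcon x₀))
  obtain ⟨p, hp, hpa, -⟩ := hhc.exists_contDiff_approx 1 (ε := fun _ => m / 3) (by fun_prop)
    (fun _ => by positivity)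
  have hpn : ∀ x, ‖p x‖ ≤ 1 + m / 3 := by
    intro x
    have := hpa x
    rw [dist_eq_norm] at this
    have h2 := norm_le_norm_add_norm_sub' (p x) (h x)
    linarith [hhm x]
  obtain ⟨x, hx, hfx⟩ := brouwer_C1 (fun x => (1 + m / 3)⁻¹ • p x) (contDiff_const.smul hp) (by
    intro x _
    rw [norm_smul, norm_inv, Real.norm_of_nonneg (by positivity), inv_mul_le_iff₀ (by positivity)]
    simpa using hpn x)
  have e1 : p x = (1 + m / 3) • x := by
    conv_rhs => rw [← hfx]
    rw [smul_smul, mul_inv_cancel₀ (by positivity), one_smul]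
  have e2 : ‖p x - x‖ ≤ m / 3 := by
    have : p x - x = (m / 3) • x := by rw [e1]; module
    rw [this, norm_smul, Real.norm_of_nonneg (by positivity)]
    nlinarith
  have e3 := hpa x
  rw [dist_eq_norm, norm_sub_rev] at e3
  have e4 : m ≤ ‖h x - x‖ := hmin (by simpa using hx)
  have e5 : ‖h x - x‖ ≤ ‖h x - p x‖ + ‖p x - x‖ := norm_sub_le_norm_sub_add_norm_sub _ _ _
  linarith

lemma brouwer_simplex {ι : Type*} [Fintype ι] [Nonempty ι] (φ : (ι → ℝ) → ι → ℝ)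
    (hφ : ContinuousOn φ (stdSimplex ℝ ι)) (hm : ∀ x ∈ stdSimplex ℝ ι, φ x ∈ stdSimplex ℝ ι) :
    ∃ x ∈ stdSimplex ℝ ι, φ x = x := by
  set s : (ι → ℝ) → ℝ := fun x => ∑ i, max (x i) 0 with hs
  have hsc : Continuous s := by fun_prop
  set ρ : (ι → ℝ) → ι → ℝ := fun x i =>
    (max (x i) 0 + max (1 - s x) 0 / Fintype.card ι) / max (s x) 1 with hρ
  have hpos : ∀ x, 0 < max (s x) 1 := fun x => lt_max_of_lt_right one_pos
  have hρc : Continuous ρ := by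
    refine continuous_pi fun i => ?_
    exact Continuous.div (by fun_prop) (by fun_prop) fun x => (hpos x).ne'
  have hcard : (0:ℝ) < Fintype.card ι := by exact_mod_cast Fintype.card_pos
  have hρm : ∀ x, ρ x ∈ stdSimplex ℝ ι := by
    intro x
    refine ⟨fun i => div_nonneg (add_nonneg (le_max_right _ _)
      (div_nonneg (le_max_right _ _) hcard.le)) (hpos x).le, ?_⟩
    simp only [hρ]
    rw [← Finset.sum_div, Finset.sum_add_distrib, div_eq_one_iff_eq (hpos x).ne']
    rw [Finset.sum_const, Finset.card_univ, nsmul_eq_mul, mul_div_cancel₀ _ hcard.ne']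
    change s x + _ = _
    rcases le_total (s x) 1 with h | h
    · rw [max_eq_left (by linarith), max_eq_right h]; ring
    · rw [max_eq_right (by linarith), max_eq_left h]; ring
  have hρid : ∀ x ∈ stdSimplex ℝ ι, ρ x = x := by
    intro x hx
    have h1 : s x = 1 := by
      rw [hs, ← hx.2]
      exact Finset.sum_congr rfl fun i _ => max_eq_left (hx.1 i)
    ext i
    simp [hρ, h1, hx.1 i]
  have hc : Continuous (fun y : EuclideanSpace ℝ ι => WithLp.toLp 2 (φ (ρ (WithLp.ofLp y)))) := by
    have h1 : Continuous (fun x => φ (ρ x)) := hφ.comp_continuous hρc hρm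
    exact (PiLp.continuous_toLp 2 _).comp (h1.comp (PiLp.continuous_ofLp 2 _))
  obtain ⟨y, hy⟩ := brouwer_ball _ hc (Fintype.card ι) hcard (by
    intro y
    have hmem := hm _ (hρm (WithLp.ofLp y))
    rw [EuclideanSpace.norm_eq]
    apply Real.sqrt_le_iff.2 ⟨hcard.le, ?_⟩
    calc _ ≤ ∑ i : ι, (1:ℝ) := by
          apply Finset.sum_le_sum
          intro i _
          have h0 := hmem.1 i
          have h1 : φ (ρ (WithLp.ofLp y)) i ≤ 1 := by
            rw [← hmem.2]; exact Finset.single_le_sum (fun j _ => hmem.1 j) (Finset.mem_univ i)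
          simp only [Real.norm_eq_abs, sq_abs]
          nlinarith
      _ = (Fintype.card ι : ℝ) := by simp
      _ ≤ _ := by
        have : (1:ℝ) ≤ Fintype.card ι := by exact_mod_cast Fintype.card_pos
        nlinarith)
  have hy' : φ (ρ (WithLp.ofLp y)) = WithLp.ofLp y := congrArg WithLp.ofLp hy
  have hmem : WithLp.ofLp y ∈ stdSimplex ℝ ι := by rw [← hy']; exact hm _ (hρm _)
  refine ⟨_, hmem, ?_⟩
  rwa [hρid _ hmem] at hy'

lemma kkm_point {ι : Type*} [Fintype ι] [Nonempty ι] (g : (ι → ℝ) → ι → ℝ) (b : ι → ℝ)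
    (hg : ContinuousOn g (stdSimplex ℝ ι)) (hb : ∑ i, b i = 1)
    (h0 : ∀ x ∈ stdSimplex ℝ ι, ∀ i, x i = 0 → g x i ≤ b i)
    (hsum : ∀ x ∈ stdSimplex ℝ ι, ∑ i, g x i = 1) :
    ∃ x ∈ stdSimplex ℝ ι, g x = b := by
  set m : (ι → ℝ) → ι → ℝ := fun x i => max (b i - g x i) 0 with hm
  set S : (ι → ℝ) → ℝ := fun x => ∑ i, m x i with hS
  have hm0 : ∀ x i, 0 ≤ m x i := fun x i => le_max_right _ _
  have hS0 : ∀ x, 0 ≤ S x := fun x => Finset.sum_nonneg fun i _ => hm0 x i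
  have hgi : ∀ i, ContinuousOn (fun x => g x i) (stdSimplex ℝ ι) := fun i =>
    (continuous_apply i).comp_continuousOn hg
  have hmc : ∀ i, ContinuousOn (fun x => m x i) (stdSimplex ℝ ι) := fun i =>
    ((continuous_const.sub continuous_id).max continuous_const).comp_continuousOn (hgi i)
  have hSc : ContinuousOn S (stdSimplex ℝ ι) := continuousOn_finsetSum _ fun i _ => hmc i
  obtain ⟨x, hx, hfx⟩ := brouwer_simplex (fun x i => (x i + m x i) / (1 + S x))
    (continuousOn_pi.2 fun i => ((continuous_apply i).continuousOn.add (hmc i)).div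
      (continuousOn_const.add hSc) fun x _ => by have := hS0 x; positivity)
    (by
      intro x hx
      refine ⟨fun i => div_nonneg (add_nonneg (hx.1 i) (hm0 x i)) (by have := hS0 x; positivity), ?_⟩
      rw [← Finset.sum_div, Finset.sum_add_distrib, hx.2]
      exact div_self (by have := hS0 x; positivity))
  refine ⟨x, hx, ?_⟩
  have hxi : ∀ i, m x i = x i * S x := by
    intro i
    have := congrFun hfx i
    have h1 := hS0 x
    rw [div_eq_iff (by positivity)] at this
    linarith
  have hle : ∀ i, b i ≤ g x i := by
    by_contra hcon
    push Not at hcon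
    obtain ⟨i, hi⟩ := hcon
    have : ∃ j, b j < g x j := by
      by_contra hc
      push Not at hc
      have : ∑ j, g x j < ∑ j, b j := Finset.sum_lt_sum (fun j _ => hc j) ⟨i, Finset.mem_univ i, hi⟩
      rw [hsum x hx, hb] at this
      exact lt_irrefl _ this
    obtain ⟨j, hj⟩ := this
    have hmi : 0 < m x i := lt_max_of_lt_left (by linarith)
    have hSp : 0 < S x := hmi.trans_le (Finset.single_le_sum (fun k _ => hm0 x k) (Finset.mem_univ i))
    have hmj : m x j = 0 := max_eq_right (by linarith)
    rw [hxi j] at hmj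
    have := h0 x hx j ((mul_eq_zero.1 hmj).resolve_right hSp.ne')
    linarith
  have heq := (Finset.sum_eq_sum_iff_of_le (s := Finset.univ) fun i _ => hle i).1
    (by rw [hb, hsum x hx])
  ext i
  exact (heq i (Finset.mem_univ i)).symm

lemma colorful_kkm {ι : Type*} [Fintype ι] [DecidableEq ι] [Nonempty ι]
    (f : ι → ι → (ι → ℝ) → ℝ) (hc : ∀ j i, Continuous (f j i))
    (hnn : ∀ j i x, 0 ≤ f j i x)
    (hbd : ∀ j i, ∀ x ∈ stdSimplex ℝ ι, x i = 0 → f j i x = 0)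
    (hcov : ∀ j, ∀ x ∈ stdSimplex ℝ ι, ∃ i, 0 < f j i x) :
    ∃ x ∈ stdSimplex ℝ ι, ∃ σ : Equiv.Perm ι, ∀ i, 0 < f (σ i) i x := by
  have hcard : (0:ℝ) < Fintype.card ι := by exact_mod_cast Fintype.card_pos
  set T : ι → (ι → ℝ) → ℝ := fun j x => ∑ k, f j k x with hT
  have hTc : ∀ j, Continuous (T j) := fun j => continuous_finsetSum _ fun i _ => hc j i
  have hTp : ∀ j, ∀ x ∈ stdSimplex ℝ ι, 0 < T j x := by
    intro j x hx
    obtain ⟨i, hi⟩ := hcov j x hx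
    exact hi.trans_le (Finset.single_le_sum (fun k _ => hnn j k x) (Finset.mem_univ i))
  obtain ⟨x, hx, hgx⟩ := kkm_point (fun x i => (∑ j, f j i x / T j x) / Fintype.card ι)
    (fun _ => 1 / Fintype.card ι)
    (continuousOn_pi.2 fun i => (continuousOn_finsetSum _ fun j _ =>
      (hc j i).continuousOn.div (hTc j).continuousOn fun x hx => (hTp j x hx).ne').div_const _)
    (by simp)
    (by
      intro x hx i hi
      simp only [hbd _ i x hx hi]
      simp)
    (by
      intro x hx
      rw [← Finset.sum_div, Finset.sum_comm, div_eq_one_iff_eq hcard.ne']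
      rw [Finset.sum_congr rfl fun j _ => by
        rw [← Finset.sum_div, div_self (hTp j x hx).ne']]
      simp)
  refine ⟨x, hx, ?_⟩
  have hM : (Matrix.of fun i j => f j i x / T j x) ∈ doublyStochastic ℝ ι := by
    rw [mem_doublyStochastic_iff_sum]
    refine ⟨fun i j => div_nonneg (hnn _ _ _) (hTp j x hx).le, fun i => ?_, fun j => ?_⟩
    · have := congrFun hgx i
      rw [div_left_inj' hcard.ne'] at this
      exact this
    · change ∑ i, f j i x / T j x = 1
      rw [← Finset.sum_div, div_self (hTp j x hx).ne']
  obtain ⟨w, hw0, hw1, hw⟩ := exists_eq_sum_perm_of_mem_doublyStochastic hM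
  have : ∃ σ, 0 < w σ := by
    by_contra hcon
    push Not at hcon
    have := Finset.sum_nonpos fun σ (_ : σ ∈ Finset.univ) => hcon σ
    linarith
  obtain ⟨σ, hσ⟩ := this
  refine ⟨σ, fun i => ?_⟩
  have h1 := congrFun (congrFun hw i) (σ i)
  rw [Matrix.sum_apply] at h1
  have h2 : 0 < f (σ i) i x / T (σ i) x := by
    change _ = f (σ i) i x / T (σ i) x at h1
    rw [← h1]
    refine Finset.sum_pos' (fun τ _ => ?_) ⟨σ, Finset.mem_univ σ, ?_⟩
    · simp only [Matrix.smul_apply, smul_eq_mul]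
      refine mul_nonneg (hw0 τ) ?_
      simp only [Equiv.Perm.permMatrix, PEquiv.toMatrix_apply]
      split_ifs <;> norm_num
    · simp [Equiv.Perm.permMatrix, PEquiv.toMatrix_apply, hσ]
  exact (div_pos_iff_of_pos_right (hTp _ x hx)).1 h2

end

lemma isClosed_convexHull_compact {U : Set Plane} (hU : IsCompact U) :
    IsClosed (convexHull ℝ U) := by
  set Φ : ∀ n : ℕ, (Fin n → ℝ) × (Fin n → Plane) → Plane := fun n a => ∑ i, a.1 i • a.2 i with hΦ
  have hc : ∀ n, IsCompact (Φ n '' (stdSimplex ℝ (Fin n) ×ˢ (Set.univ.pi fun _ => U))) := by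
    intro n
    refine ((isCompact_stdSimplex ℝ (Fin n)).prod (isCompact_univ_pi fun _ => hU)).image ?_
    simp only [hΦ]
    fun_prop
  have he : convexHull ℝ U = ⋃ n ∈ Finset.range 4,
      Φ n '' (stdSimplex ℝ (Fin n) ×ˢ (Set.univ.pi fun _ => U)) := by
    apply Subset.antisymm
    · intro p hp
      obtain ⟨ι, hι, z, w, hz, hai, hw, hw1, hp⟩ := eq_pos_convex_span_of_mem_convexHull hp
      have hcard : Fintype.card ι < 4 := by
        have h1 := hai.card_le_finrank_succ
        have h2 := Submodule.finrank_le (vectorSpan ℝ (Set.range z))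
        rw [finrank_euclideanSpace_fin] at h2
        omega
      let e := (Fintype.equivFin ι).symm
      refine mem_iUnion₂.2 ⟨Fintype.card ι, Finset.mem_range.2 hcard, (w ∘ e, z ∘ e), ?_, ?_⟩
      · refine ⟨⟨fun i => (hw _).le, ?_⟩, fun i _ => hz ⟨_, rfl⟩⟩
        rw [← hw1]; exact Equiv.sum_comp e w
      · rw [← hp]; exact Equiv.sum_comp e fun i => w i • z i
    · refine iUnion₂_subset fun n _ => ?_
      rintro _ ⟨⟨w, z⟩, ⟨hw, hz⟩, rfl⟩
      exact (convex_convexHull ℝ U).sum_mem (fun i _ => hw.1 i) hw.2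
        fun i _ => subset_convexHull ℝ U (hz i trivial)
  rw [he]
  exact ((Finset.range 4).isCompact_biUnion fun n _ => hc n).isClosed

lemma isLine_of_eq (A B C : ℝ) (h : 0 < A ^ 2 + B ^ 2) :
    IsLine {p : Plane | A * p 0 + B * p 1 = C} := by
  refine ⟨!₂[A * C / (A ^ 2 + B ^ 2), B * C / (A ^ 2 + B ^ 2)], !₂[-B, A], ?_, ?_⟩
  · intro h0
    have h1 := congrArg (fun v : Plane => v 0) h0
    have h2 := congrArg (fun v : Plane => v 1) h0
    simp at h1 h2
    simp [h1, h2] at h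
  · ext p
    constructor
    · intro hp
      have hp : A * p 0 + B * p 1 = C := hp
      refine ⟨(A * p 1 - B * p 0) / (A ^ 2 + B ^ 2), ?_⟩
      ext i
      fin_cases i
      · simp; field_simp; rw [← hp]; ring
      · simp; field_simp; rw [← hp]; ring
    · rintro ⟨t, rfl⟩
      simp
      field_simp; ring

lemma exists_coords {U : Set Plane} (hU : IsCompact U) (q : Plane) (hq : q ∉ convexHull ℝ U) :
    ∃ X Y : Plane → ℝ, Continuous X ∧ Continuous Y ∧ X q = 1 ∧ Y q = 0 ∧
      (∀ p r : Plane, ∀ s t : ℝ, s + t = 1 → X (s • p + t • r) = s * X p + t * X r) ∧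
      (∀ p r : Plane, ∀ s t : ℝ, s + t = 1 → Y (s • p + t • r) = s * Y p + t * Y r) ∧
      (∀ p ∈ U, X p ^ 2 + Y p ^ 2 < 1) ∧
      (∀ A B C : ℝ, 0 < A ^ 2 + B ^ 2 → IsLine {p | X p * A + Y p * B - C = 0}) := by
  have key : ∃ α β δ : ℝ, 0 < α ^ 2 + β ^ 2 ∧ 0 < δ ∧
      ∀ p ∈ U, δ ≤ α * (p 0 - q 0) + β * (p 1 - q 1) := by
    rcases U.eq_empty_or_nonempty with rfl | ⟨p₀, hp₀⟩
    · exact ⟨1, 0, 1, by norm_num, by norm_num, by simp⟩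
    obtain ⟨f, u, hfu, hf⟩ := geometric_hahn_banach_point_closed (convex_convexHull ℝ U)
      (isClosed_convexHull_compact hU) hq
    have hlin : ∀ p : Plane, f p = f (EuclideanSpace.single 0 1) * p 0
        + f (EuclideanSpace.single 1 1) * p 1 := by
      intro p
      have : p = p 0 • EuclideanSpace.single 0 (1:ℝ) + p 1 • EuclideanSpace.single 1 (1:ℝ) := by
        ext i; fin_cases i <;> simp
      conv_lhs => rw [this]
      simp [mul_comm]
    set α := f (EuclideanSpace.single 0 1)
    set β := f (EuclideanSpace.single 1 1)
    refine ⟨α, β, u - f q, ?_, by linarith, fun p hp => ?_⟩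
    · have h1 := hf p₀ (subset_convexHull ℝ U hp₀)
      by_contra hcon
      have ha : α = 0 := by nlinarith [sq_nonneg α, sq_nonneg β]
      have hb : β = 0 := by nlinarith [sq_nonneg α, sq_nonneg β]
      rw [hlin, ha, hb] at hfu h1
      linarith
    · have := hf p (subset_convexHull ℝ U hp)
      rw [hlin] at this
      rw [hlin q]
      linarith
  obtain ⟨α, β, δ, hN, hδ, hs⟩ := key
  set s : Plane → ℝ := fun p => α * (p 0 - q 0) + β * (p 1 - q 1) with hsdef
  set t : Plane → ℝ := fun p => β * (p 0 - q 0) - α * (p 1 - q 1) with htdef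
  have hsc : Continuous s := by fun_prop
  have htc : Continuous t := by fun_prop
  obtain ⟨M, hM⟩ := hU.exists_bound_of_continuousOn
    (f := fun p => s p ^ 2 + t p ^ 2) (by fun_prop)
  set k := δ / (|M| + 1) with hk
  have hk0 : 0 < k := by positivity
  refine ⟨fun p => 1 - k * s p, fun p => k * t p, by fun_prop, by fun_prop,
    by simp [hsdef], by simp [htdef], ?_, ?_, ?_, ?_⟩
  · intro p r a b hab
    simp [hsdef]
    linear_combination (-1 + k * (- α * q 0 - β * q 1)) * hab
  · intro p r a b hab
    simp [htdef]
    linear_combination (k * (β * q 0 - α * q 1)) * hab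
  · intro p hp
    have h1 : s p ^ 2 + t p ^ 2 ≤ |M| + 1 := by
      have := hM p hp
      rw [Real.norm_eq_abs] at this
      linarith [le_abs_self (s p ^ 2 + t p ^ 2), le_abs_self M]
    have h2 : k * (s p ^ 2 + t p ^ 2) ≤ δ := by
      calc _ ≤ k * (|M| + 1) := mul_le_mul_of_nonneg_left h1 hk0.le
        _ = δ := by rw [hk]; field_simp
    have h3 : δ ≤ s p := hs p hp
    have h4 : k * (k * (s p ^ 2 + t p ^ 2) - 2 * s p) < 0 :=
      mul_neg_of_pos_of_neg hk0 (by linarith)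
    nlinarith
  · intro A B C hAB
    have := isLine_of_eq (k * (-A * α + B * β)) (k * (-A * β - B * α))
      (C - A + k * (-A * α + B * β) * q 0 + k * (-A * β - B * α) * q 1) (by
        have : (k * (-A * α + B * β)) ^ 2 + (k * (-A * β - B * α)) ^ 2
          = k ^ 2 * ((A ^ 2 + B ^ 2) * (α ^ 2 + β ^ 2)) := by ring
        rw [this]; positivity)
    convert this using 1
    ext p
    simp only [mem_setOf_eq, hsdef, htdef]
    constructor <;> intro h <;> linear_combination h

/-- signed chord function of the unit circle -/
noncomputable def chordH (a b X Y : ℝ) : ℝ :=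
  X * Real.cos ((a + b) / 2) + Y * Real.sin ((a + b) / 2) - Real.cos ((b - a) / 2)

lemma chordH_shift (a b X Y : ℝ) : chordH b (a + 2 * Real.pi) X Y = - chordH a b X Y := by
  have e1 : (b + (a + 2 * Real.pi)) / 2 = (a + b) / 2 + Real.pi := by ring
  have e2 : (a + 2 * Real.pi - b) / 2 = Real.pi - (b - a) / 2 := by ring
  simp only [chordH]
  rw [e1, e2, Real.cos_add_pi, Real.sin_add_pi, Real.cos_pi_sub]; ring

lemma chordH_mono (a b c X Y : ℝ) (hXY : X ^ 2 + Y ^ 2 < 1) (hab : a ≤ b) (hbc : b ≤ c)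
    (hca : c ≤ a + 2 * Real.pi) (h : 0 < chordH a b X Y) : 0 ≤ chordH a c X Y := by
  set A := X * Real.cos a + Y * Real.sin a with hA
  set B := -X * Real.sin a + Y * Real.cos a with hB
  have hA1 : A < 1 := by
    have : A ^ 2 + B ^ 2 = X ^ 2 + Y ^ 2 := by
      rw [hA, hB]; linear_combination (X ^ 2 + Y ^ 2) * Real.sin_sq_add_cos_sq a
    nlinarith [sq_nonneg B]
  have hform : ∀ d, chordH a d X Y =
      -(1 - A) * Real.cos ((d - a) / 2) + B * Real.sin ((d - a) / 2) := by
    intro d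
    have : (a + d) / 2 = a + (d - a) / 2 := by ring
    simp only [chordH]
    rw [this, Real.cos_add, Real.sin_add, hA, hB]; ring
  rw [hform] at h ⊢
  set β := (b - a) / 2 with hβ
  set γ := (c - a) / 2 with hγ
  have h0 : 0 ≤ β := by rw [hβ]; linarith
  have h1 : β ≤ γ := by rw [hβ, hγ]; linarith
  have h2 : γ ≤ Real.pi := by rw [hγ]; linarith
  rcases eq_or_lt_of_le h0 with h3 | h3
  · rw [← h3] at h; simp at h; linarith
  rcases eq_or_lt_of_le (h1.trans h2) with h4 | h4
  · have : γ = β := le_antisymm (h4 ▸ h2) h1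
    rw [this]; exact h.le
  have h5 : 0 < Real.sin β := Real.sin_pos_of_pos_of_lt_pi h3 h4
  have h6 : 0 ≤ Real.sin γ := Real.sin_nonneg_of_nonneg_of_le_pi (h0.trans h1) h2
  have h7 : 0 ≤ Real.sin (γ - β) :=
    Real.sin_nonneg_of_nonneg_of_le_pi (by linarith) (by linarith)
  have h8 : Real.sin β * (-(1 - A) * Real.cos γ + B * Real.sin γ)
      = Real.sin γ * (-(1 - A) * Real.cos β + B * Real.sin β)
        + Real.sin (γ - β) * (1 - A) := by
    rw [Real.sin_sub]; ring
  have h9 : 0 ≤ Real.sin β * (-(1 - A) * Real.cos γ + B * Real.sin γ) := by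
    rw [h8]
    have := mul_nonneg h6 h.le
    have := mul_nonneg h7 (by linarith : 0 ≤ 1 - A)
    linarith
  exact nonneg_of_mul_nonneg_right h9 h5

lemma no_both (m0 m1 m2 d0 d1 d2 X Y X' Y' : ℝ) (h01 : m0 ≤ m1) (h12 : m1 ≤ m2)
    (h20 : m2 ≤ m0 + Real.pi)
    (p0 : 0 < X * Real.cos m0 + Y * Real.sin m0 - d0)
    (p1 : X * Real.cos m1 + Y * Real.sin m1 - d1 < 0)
    (p2 : 0 < X * Real.cos m2 + Y * Real.sin m2 - d2)
    (q0 : X' * Real.cos m0 + Y' * Real.sin m0 - d0 < 0)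
    (q1 : 0 < X' * Real.cos m1 + Y' * Real.sin m1 - d1)
    (q2 : X' * Real.cos m2 + Y' * Real.sin m2 - d2 < 0) : False := by
  rcases eq_or_lt_of_le h01 with e | l01
  · subst e; linarith
  rcases eq_or_lt_of_le h12 with e | l12
  · subst e; linarith
  have s21 : 0 < Real.sin (m2 - m1) := Real.sin_pos_of_pos_of_lt_pi (by linarith) (by linarith)
  have s10 : 0 < Real.sin (m1 - m0) := Real.sin_pos_of_pos_of_lt_pi (by linarith) (by linarith)
  have s20 : 0 ≤ Real.sin (m2 - m0) :=
    Real.sin_nonneg_of_nonneg_of_le_pi (by linarith) (by linarith)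
  have i1 : Real.sin (m2 - m1) * Real.cos m0 - Real.sin (m2 - m0) * Real.cos m1
      + Real.sin (m1 - m0) * Real.cos m2 = 0 := by
    simp only [Real.sin_sub]; ring
  have i2 : Real.sin (m2 - m1) * Real.sin m0 - Real.sin (m2 - m0) * Real.sin m1
      + Real.sin (m1 - m0) * Real.sin m2 = 0 := by
    simp only [Real.sin_sub]; ring
  have a0 := mul_pos s21 (sub_pos.2 (q0.trans p0))
  have a1 := mul_nonneg s20 (sub_pos.2 (p1.trans q1)).le
  have a2 := mul_pos s10 (sub_pos.2 (q2.trans p2))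
  have : (X - X') * (Real.sin (m2 - m1) * Real.cos m0 - Real.sin (m2 - m0) * Real.cos m1
      + Real.sin (m1 - m0) * Real.cos m2) + (Y - Y') * (Real.sin (m2 - m1) * Real.sin m0
      - Real.sin (m2 - m0) * Real.sin m1 + Real.sin (m1 - m0) * Real.sin m2) = 0 := by
    rw [i1, i2]; ring
  linarith

/-- angles of the six points on the circle -/
noncomputable def ang (x : Fin 6 → ℝ) (k : ℕ) : ℝ :=
  2 * Real.pi * ∑ i ∈ Finset.range k, x (Fin.ofNat 6 i)

lemma ang_succ (x : Fin 6 → ℝ) (k : ℕ) :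
    ang x (k + 1) = ang x k + 2 * Real.pi * x (Fin.ofNat 6 k) := by
  simp only [ang, Finset.sum_range_succ]; ring

lemma ang_mono {x : Fin 6 → ℝ} (hx : x ∈ stdSimplex ℝ (Fin 6)) : Monotone (ang x) := by
  refine monotone_nat_of_le_succ fun k => ?_
  rw [ang_succ]
  have := mul_nonneg Real.two_pi_pos.le (hx.1 (Fin.ofNat 6 k))
  linarith

lemma ang_period {x : Fin 6 → ℝ} (hx : x ∈ stdSimplex ℝ (Fin 6)) (k : ℕ) :
    ang x (k + 6) = ang x k + 2 * Real.pi := by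
  induction k with
  | zero =>
    have h := hx.2
    rw [Fin.sum_univ_six] at h
    have : ∑ i ∈ Finset.range 6, x (Fin.ofNat 6 i) = 1 := by
      rw [← h]; simp only [Finset.sum_range_succ, Finset.sum_range_zero, zero_add]; rfl
    simp only [ang, zero_add, this]
    simp
  | succ k ih =>
    have e : Fin.ofNat 6 (k + 6) = Fin.ofNat 6 k := by
      apply Fin.ext; simp [Fin.ofNat]
    rw [show k + 1 + 6 = (k + 6) + 1 by ring, ang_succ x (k + 6), ang_succ x k, ih, e]; ring

lemma ang_cont (k : ℕ) : Continuous fun x => ang x k := by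
  unfold ang; fun_prop

/-- the line functions -/
noncomputable def lineH (x : Fin 6 → ℝ) (k : ℕ) (X Y : ℝ) : ℝ :=
  chordH (ang x k) (ang x (k + 3)) X Y

lemma lineH_shift {x : Fin 6 → ℝ} (hx : x ∈ stdSimplex ℝ (Fin 6)) (k : ℕ) (X Y : ℝ) :
    lineH x (k + 3) X Y = - lineH x k X Y := by
  unfold lineH
  rw [show k + 3 + 3 = k + 6 by ring, ang_period hx, chordH_shift]

lemma tight_swap12 {A B C : Set Plane} (h : Tight A B C) : Tight B A C := by
  obtain ⟨p, ⟨h1, h2⟩, h3⟩ := h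
  exact ⟨p, ⟨by rwa [union_comm], h3⟩, h2⟩

lemma tight_swap23 {A B C : Set Plane} (h : Tight A B C) : Tight A C B := by
  obtain ⟨p, ⟨h1, h2⟩, h3⟩ := h
  exact ⟨p, ⟨h2, h1⟩, by rwa [union_comm]⟩

lemma tight_any {F : Fin 6 → Set (Set Plane)}
    (htight : ∀ i₁ i₂ i₃ : Fin 6, i₁ < i₂ → i₂ < i₃ →
      ∀ A₁ ∈ F i₁, ∀ A₂ ∈ F i₂, ∀ A₃ ∈ F i₃, Tight A₁ A₂ A₃)
    {i j k : Fin 6} (hij : i ≠ j) (hjk : j ≠ k) (hik : i ≠ k) {A B C : Set Plane}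
    (hA : A ∈ F i) (hB : B ∈ F j) (hC : C ∈ F k) : Tight A B C := by
  rcases lt_or_gt_of_ne hij with h1 | h1 <;> rcases lt_or_gt_of_ne hjk with h2 | h2 <;>
    rcases lt_or_gt_of_ne hik with h3 | h3
  · exact htight i j k h1 h2 A hA B hB C hC
  · exact absurd (h1.trans h2) h3.asymm
  · exact tight_swap23 (htight i k j h3 h2 A hA C hC B hB)
  · exact tight_swap23 (tight_swap12 (htight k i j h3 h1 C hC A hA B hB))
  · exact tight_swap12 (htight j i k h1 h3 B hB A hA C hC)
  · exact tight_swap12 (tight_swap23 (htight j k i h2 h3 B hB C hC A hA))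
  · exact absurd (h2.trans h1) h3.asymm
  · exact tight_swap12 (tight_swap23 (tight_swap12 (htight k j i h2 h1 C hC B hB A hA)))

lemma sign_const {S : Set Plane} (hS : IsPreconnected S) {h : Plane → ℝ} (hc : Continuous h)
    (h0 : ∀ p ∈ S, h p ≠ 0) : (∀ p ∈ S, 0 < h p) ∨ (∀ p ∈ S, h p < 0) := by
  by_contra hcon
  push Not at hcon
  obtain ⟨⟨p, hp, hp1⟩, r, hr, hr1⟩ := hcon
  obtain ⟨z, hz, hz0⟩ := hS.intermediate_value hp hr hc.continuousOn ⟨hp1, hr1⟩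
  exact h0 z hz hz0

theorem stmt_12 (F : Fin 6 → Set (Set Plane))
    (hfin : ∀ j, (F j).Finite)
    (hne : ∀ j, ∀ S ∈ F j, S.Nonempty)
    (hcpt : ∀ j, ∀ S ∈ F j, IsCompact S)
    (hconn : ∀ j, ∀ S ∈ F j, IsConnected S)
    (htight : ∀ i₁ i₂ i₃ : Fin 6, i₁ < i₂ → i₂ < i₃ →
      ∀ A₁ ∈ F i₁, ∀ A₂ ∈ F i₂, ∀ A₃ ∈ F i₃, Tight A₁ A₂ A₃)
    (q : Plane) (hq : q ∉ convexHull ℝ (⋃ j, ⋃ S ∈ F j, S)) :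
    ∃ i : Fin 6, ∃ l₁ l₂ l₃ : Set Plane,
      IsLine l₁ ∧ IsLine l₂ ∧ IsLine l₃ ∧
      (∀ S ∈ F i, (S ∩ (l₁ ∪ l₂ ∪ l₃)).Nonempty) ∧
      (q ∈ l₁ ∨ q ∈ l₂ ∨ q ∈ l₃) := by
  by_contra hcon
  push Not at hcon
  have hU : IsCompact (⋃ j, ⋃ S ∈ F j, S) :=
    isCompact_iUnion fun j => (hfin j).isCompact_biUnion fun S hS => hcpt j S hS
  obtain ⟨X, Y, hX, hY, hXq, hYq, hXa, hYa, hdisc, hline⟩ := exists_coords hU q hq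
  have hmemU : ∀ j, ∀ S ∈ F j, ∀ p ∈ S, X p ^ 2 + Y p ^ 2 < 1 := fun j S hS p hp =>
    hdisc p (mem_iUnion.2 ⟨j, mem_iUnion₂.2 ⟨S, hS, hp⟩⟩)
  set L : (Fin 6 → ℝ) → ℕ → Plane → ℝ := fun x k p => lineH x k (X p) (Y p) with hL
  have hLc : ∀ k, Continuous fun z : (Fin 6 → ℝ) × Plane => L z.1 k z.2 := by
    intro k
    have h1 := ang_cont k
    have h2 := ang_cont (k + 3)
    simp only [hL, lineH, chordH]
    fun_prop
  have hLc' : ∀ x k, Continuous (L x k) := fun x k =>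
    (hLc k).comp (Continuous.prodMk_right x)
  have hLs : ∀ x ∈ stdSimplex ℝ (Fin 6), ∀ k p, L x (k + 3) p = - L x k p :=
    fun x hx k p => lineH_shift hx k _ _
  set A : Fin 6 → Fin 6 → Set (Fin 6 → ℝ) := fun j i =>
    {x | ∃ S ∈ F j, ∀ p ∈ S, 0 < L x i p ∧ L x (i + 1 : ℕ) p < 0} with hA
  have hAo : ∀ j i, IsOpen (A j i) := by
    intro j i
    have : A j i = ⋃ S ∈ F j, {x | ∀ p ∈ S, 0 < L x i p ∧ L x (i + 1 : ℕ) p < 0} := by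
      ext x; simp [hA]
    rw [this]
    refine isOpen_biUnion fun S hS => isOpen_iff_mem_nhds.2 fun x hx => ?_
    refine (hcpt j S hS).eventually_forall_of_forall_eventually fun p hp => ?_
    have h1 := hx p hp
    exact (((hLc i).tendsto (x, p)).eventually (lt_mem_nhds h1.1)).and
      (((hLc (i + 1)).tendsto (x, p)).eventually (gt_mem_nhds h1.2))
  choose f hfs hfc hfr using fun j i => (hAo j i).exists_contDiff_support_eq (n := 0)
  have hf0 : ∀ j i x, 0 ≤ f j i x := fun j i x => (hfr j i ⟨x, rfl⟩).1
  have hfpos : ∀ j i x, 0 < f j i x ↔ x ∈ A j i := by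
    intro j i x
    rw [← hfs j i, Function.mem_support]
    exact ⟨fun h => h.ne', fun h => lt_of_le_of_ne (hf0 j i x) (Ne.symm h)⟩
  obtain ⟨x, hx, σ, hσ⟩ := colorful_kkm f (fun j i => (hfc j i).continuous) hf0
    (by
      intro j i x hx hi
      by_contra hne0
      have hmem : x ∈ A j i := (hfpos j i x).1 (lt_of_le_of_ne (hf0 j i x) (Ne.symm hne0))
      obtain ⟨S, hS, hSp⟩ := hmem
      obtain ⟨p, hp⟩ := hne j S hS
      obtain ⟨h1, h2⟩ := hSp p hp
      have e : ang x (i + 1) = ang x i := by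
        have : Fin.ofNat 6 (i : ℕ) = i := by apply Fin.ext; simp [Fin.ofNat]
        rw [ang_succ, this, hi]; ring
      simp only [hL, lineH] at h1 h2
      rw [e] at h2
      have hm := ang_mono hx
      have := chordH_mono (ang x i) (ang x (i + 3)) (ang x (i + 1 + 3)) (X p) (Y p)
        (hmemU j S hS p hp) (hm (by omega)) (hm (by omega))
        (by rw [← ang_period hx]; exact hm (by omega)) h1
      linarith)
    (by
      intro j x hx
      have hl : ∀ k, IsLine {p | L x k p = 0} := fun k => hline _ _ _ (by
        rw [Real.cos_sq_add_sin_sq]; exact one_pos)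
      have h1 := hcon j _ _ _ (hl 0) (hl 1) (hl 2)
      have hq0 : q ∈ {p | L x 0 p = 0} := by
        simp [hL, lineH, chordH, hXq, hYq, ang]
      have h2 : ∃ S ∈ F j, ¬ (S ∩ ({p | L x 0 p = 0} ∪ {p | L x 1 p = 0}
          ∪ {p | L x 2 p = 0})).Nonempty := by
        by_contra hc
        push Not at hc
        exact (h1 hc).1 hq0
      obtain ⟨S, hS, hSn⟩ := h2
      have hs := fun k (h : ∀ p ∈ S, L x k p ≠ 0) =>
        sign_const (hconn j S hS).isPreconnected (hLc' x k) h
      have s0 := hs 0 fun p hp h => hSn ⟨p, hp, Or.inl (Or.inl h)⟩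
      have s1 := hs 1 fun p hp h => hSn ⟨p, hp, Or.inl (Or.inr h)⟩
      have s2 := hs 2 fun p hp h => hSn ⟨p, hp, Or.inr h⟩
      have e3 := fun p => hLs x hx 0 p
      have e4 := fun p => hLs x hx 1 p
      have e5 := fun p => hLs x hx 2 p
      have e6 := fun p => hLs x hx 3 p
      simp only [hfpos]
      norm_num at e3 e4 e5 e6
      rcases s0 with s0 | s0 <;> rcases s1 with s1 | s1 <;> rcases s2 with s2 | s2
      · exact ⟨2, S, hS, fun p hp => ⟨s2 p hp, by
          change L x 3 p < 0; linarith [e3 p, s0 p hp]⟩⟩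
      · exact ⟨1, S, hS, fun p hp => ⟨s1 p hp, s2 p hp⟩⟩
      · exact ⟨0, S, hS, fun p hp => ⟨s0 p hp, s1 p hp⟩⟩
      · exact ⟨0, S, hS, fun p hp => ⟨s0 p hp, s1 p hp⟩⟩
      · exact ⟨3, S, hS, fun p hp => ⟨by
          change 0 < L x 3 p; linarith [e3 p, s0 p hp], by
          change L x 4 p < 0; linarith [e4 p, s1 p hp]⟩⟩
      · exact ⟨3, S, hS, fun p hp => ⟨by
          change 0 < L x 3 p; linarith [e3 p, s0 p hp], by
          change L x 4 p < 0; linarith [e4 p, s1 p hp]⟩⟩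
      · exact ⟨4, S, hS, fun p hp => ⟨by
          change 0 < L x 4 p; linarith [e4 p, s1 p hp], by
          change L x 5 p < 0; linarith [e5 p, s2 p hp]⟩⟩
      · exact ⟨5, S, hS, fun p hp => ⟨by
          change 0 < L x 5 p; linarith [e5 p, s2 p hp], by
          change L x 6 p < 0; linarith [e6 p, e3 p, s0 p hp]⟩⟩)
  have hmem : ∀ i, x ∈ A (σ i) i := fun i => (hfpos _ _ _).1 (hσ i)
  choose S hS hSp using hmem
  have hσne : ∀ i j : Fin 6, i ≠ j → σ i ≠ σ j := fun i j h h' => h (σ.injective h')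
  have e3 := fun p => hLs x hx 0 p
  have e4 := fun p => hLs x hx 1 p
  have e5 := fun p => hLs x hx 2 p
  have e6 := fun p => hLs x hx 3 p
  norm_num at e3 e4 e5 e6
  have hLa : ∀ k p r (s t : ℝ), s + t = 1 →
      L x k (s • p + t • r) = s * L x k p + t * L x k r := by
    intro k p r s t hst
    simp only [hL, lineH, chordH, hXa p r s t hst, hYa p r s t hst]
    linear_combination (Real.cos ((ang x (k + 3) - ang x k) / 2)) * hst
  have hpos : ∀ k (B C : Set Plane), (∀ p ∈ B, 0 < L x k p) → (∀ p ∈ C, 0 < L x k p) →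
      ∀ p ∈ convexHull ℝ (B ∪ C), 0 < L x k p := by
    intro k B C hB hC
    refine convexHull_min (t := {p | 0 < L x k p}) (union_subset hB hC) ?_
    intro p hp r hr s t hs ht hst
    change 0 < L x k (s • p + t • r)
    rw [hLa k p r s t hst]
    have hp : 0 < L x k p := hp
    have hr : 0 < L x k r := hr
    rcases eq_or_lt_of_le hs with h | h
    · have : t = 1 := by linarith
      rw [← h, this]; linarith
    · have := mul_pos h hp
      have := mul_nonneg ht hr.le
      linarith
  have hs0 := hSp 0
  have hs1 := hSp 1
  have hs2 := hSp 2
  have hs3 := hSp 3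
  have hs4 := hSp 4
  have hs5 := hSp 5
  change ∀ p ∈ S 0, 0 < L x 0 p ∧ L x 1 p < 0 at hs0
  change ∀ p ∈ S 1, 0 < L x 1 p ∧ L x 2 p < 0 at hs1
  change ∀ p ∈ S 2, 0 < L x 2 p ∧ L x 3 p < 0 at hs2
  change ∀ p ∈ S 3, 0 < L x 3 p ∧ L x 4 p < 0 at hs3
  change ∀ p ∈ S 4, 0 < L x 4 p ∧ L x 5 p < 0 at hs4
  change ∀ p ∈ S 5, 0 < L x 5 p ∧ L x 6 p < 0 at hs5
  obtain ⟨p, ⟨hp1, hp2⟩, hp3⟩ := tight_any htight (hσne 0 2 (by decide)) (hσne 2 4 (by decide))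
    (hσne 0 4 (by decide)) (hS 0) (hS 2) (hS 4)
  obtain ⟨r, ⟨hr1, hr2⟩, hr3⟩ := tight_any htight (hσne 1 3 (by decide)) (hσne 3 5 (by decide))
    (hσne 1 5 (by decide)) (hS 1) (hS 3) (hS 5)
  have P0 : 0 < L x 0 p := hpos 0 _ _ (fun y hy => (hs0 y hy).1)
    (fun y hy => by linarith [e3 y, hs2 y hy]) p hp1
  have P1 : 0 < L x 4 p := hpos 4 _ _ (fun y hy => by linarith [e4 y, hs0 y hy])
    (fun y hy => (hs4 y hy).1) p hp2
  have P2 : 0 < L x 2 p := hpos 2 _ _ (fun y hy => (hs2 y hy).1)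
    (fun y hy => by linarith [e5 y, hs4 y hy]) p hp3
  have R1 : 0 < L x 1 r := hpos 1 _ _ (fun y hy => (hs1 y hy).1)
    (fun y hy => by linarith [e4 y, hs3 y hy]) r hr1
  have R2 : 0 < L x 5 r := hpos 5 _ _ (fun y hy => by linarith [e5 y, hs1 y hy])
    (fun y hy => (hs5 y hy).1) r hr2
  have R0 : 0 < L x 3 r := hpos 3 _ _ (fun y hy => (hs3 y hy).1)
    (fun y hy => by linarith [e6 y, hs5 y hy]) r hr3
  have hm := ang_mono hx
  have m01 : ang x 0 ≤ ang x 1 := hm (by norm_num)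
  have m12 : ang x 1 ≤ ang x 2 := hm (by norm_num)
  have m23 : ang x 2 ≤ ang x 3 := hm (by norm_num)
  have m34 : ang x 3 ≤ ang x 4 := hm (by norm_num)
  have m45 : ang x 4 ≤ ang x 5 := hm (by norm_num)
  have m56 : ang x 5 ≤ ang x 0 + 2 * Real.pi := by rw [← ang_period hx]; exact hm (by norm_num)
  have P1' : L x 1 p < 0 := by linarith [e4 p]
  have R0' : L x 0 r < 0 := by linarith [e3 r]
  have R2' : L x 2 r < 0 := by linarith [e5 r]
  exact no_both ((ang x 0 + ang x 3) / 2) ((ang x 1 + ang x 4) / 2) ((ang x 2 + ang x 5) / 2)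
    _ _ _ (X p) (Y p) (X r) (Y r) (by linarith) (by linarith) (by linarith)
    P0 P1' P2 R0' R1 R2'
end

section
/- Let F be a finite family of nonempty connected (not necessarily compact or bounded) sets in ℝ² such that every three members of F form a tight triple. Then F is pierced by 3 lines. -/
open Set

namespace Scarf
set_option linter.unusedSectionVars false
variable {T I : Type} [Fintype T] [DecidableEq T] [Fintype I] [DecidableEq I]

def Dom (r : I → T → ℕ) (p : Finset T × Finset I) : Prop :=
  ∀ y, ∃ i ∈ p.2, ∀ x ∈ p.1, r i y ≤ r i x

def Room (r : I → T → ℕ) (p : Finset T × Finset I) : Prop :=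
  Dom r p ∧ p.1.card = p.2.card

def Door (c : T → I) (i0 : I) (d : Finset T × Finset I) : Prop :=
  d.2 = insert i0 (d.1.image c) ∧ i0 ∉ d.1.image c ∧ Set.InjOn c (d.1 : Set T)

def Rel (d R : Finset T × Finset I) : Prop := d.1 ⊆ R.1 ∧ R.2 ⊆ d.2

theorem dom_of_rel {r : I → T → ℕ} {d R : Finset T × Finset I} (h : Rel d R) (hR : Dom r R) :
    Dom r d := by
  intro y
  obtain ⟨i, hi, hx⟩ := hR y
  exact ⟨i, h.2 hi, fun x hx' => hx x (h.1 hx')⟩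

theorem rel_cases {r : I → T → ℕ} {d R : Finset T × Finset I} (h : Rel d R) (hR : Room r R)
    (hd : d.2.card = d.1.card + 1) :
    (R.1 = d.1 ∧ ∃ i ∈ d.2, R.2 = d.2.erase i) ∨
    (R.2 = d.2 ∧ ∃ x, x ∉ d.1 ∧ R.1 = insert x d.1) := by
  have h1 := Finset.card_le_card h.1
  have h2 := Finset.card_le_card h.2
  have h3 := hR.2
  rcases Nat.eq_or_lt_of_le h1 with h4 | h4
  · left
    have e1 : d.1 = R.1 := Finset.eq_of_subset_of_card_le h.1 (by omega)
    refine ⟨e1.symm, ?_⟩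
    have : (d.2 \ R.2).card = 1 := by
      rw [Finset.card_sdiff_of_subset h.2]; omega
    obtain ⟨i, hi⟩ := Finset.card_eq_one.1 this
    have hi' : i ∈ d.2 \ R.2 := by rw [hi]; simp
    refine ⟨i, (Finset.mem_sdiff.1 hi').1, ?_⟩
    rw [← Finset.sdiff_singleton_eq_erase, ← hi, Finset.sdiff_sdiff_eq_self h.2]
  · right
    refine ⟨Finset.eq_of_subset_of_card_le h.2 (by omega), ?_⟩
    have : (R.1 \ d.1).card = 1 := by
      rw [Finset.card_sdiff_of_subset h.1]; omega
    obtain ⟨x, hx⟩ := Finset.card_eq_one.1 this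
    have hi' : x ∈ R.1 \ d.1 := by rw [hx]; simp
    refine ⟨x, (Finset.mem_sdiff.1 hi').2, ?_⟩
    rw [Finset.insert_eq, ← hx, Finset.sdiff_union_of_subset h.1]

theorem two_rooms (r : I → T → ℕ) (hr : ∀ i, Function.Injective (r i))
    (τ : Finset T) (D : Finset I) (hτ : τ.Nonempty) (hD : D.card = τ.card + 1)
    (hdom : Dom r (τ, D)) :
    ∃ R₁ R₂, R₁ ≠ R₂ ∧ ∀ R, (Room r R ∧ Rel (τ, D) R) ↔ (R = R₁ ∨ R = R₂) := by
  classical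
  have hm : ∀ i, ∃ x ∈ τ, ∀ y ∈ τ, r i x ≤ r i y := fun i => Finset.exists_min_image τ (r i) hτ
  choose m hmτ hmin using hm
  have muniq : ∀ i z, z ∈ τ → (∀ y ∈ τ, r i z ≤ r i y) → z = m i := by
    intro i z hz h
    exact hr i (le_antisymm (h _ (hmτ i)) (hmin i z hz))
  obtain ⟨a, ha, b, hb, hab, mab⟩ := Finset.exists_ne_map_eq_of_card_lt_of_maps_to
    (s := D) (t := τ) (by omega) (f := m) (fun i _ => hmτ i)
  have hsurj : τ ⊆ D.image m := by
    intro z hz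
    obtain ⟨i, hi, h⟩ := hdom z
    exact Finset.mem_image.2 ⟨i, hi, (muniq i z hz h).symm⟩
  have hsurja : τ ⊆ (D.erase a).image m := by
    intro z hz
    obtain ⟨i, hi, h⟩ := Finset.mem_image.1 (hsurj hz)
    by_cases hia : i = a
    · exact Finset.mem_image.2 ⟨b, by simp [hb, hab.symm], by rw [← mab, ← h, hia]⟩
    · exact Finset.mem_image.2 ⟨i, by simp [hi, hia], h⟩
  have hsurjb : τ ⊆ (D.erase b).image m := by
    intro z hz
    obtain ⟨i, hi, h⟩ := Finset.mem_image.1 (hsurj hz)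
    by_cases hia : i = b
    · exact Finset.mem_image.2 ⟨a, by simp [ha, hab], by rw [mab, ← h, hia]⟩
    · exact Finset.mem_image.2 ⟨i, by simp [hi, hia], h⟩
  have hinj : Set.InjOn m (D.erase a : Finset I) := by
    apply Finset.injOn_of_card_image_eq
    apply le_antisymm Finset.card_image_le
    rw [Finset.card_erase_of_mem ha, hD]
    simpa using Finset.card_le_card hsurja
  have key : ∀ i ∈ D, τ ⊆ (D.erase i).image m → i = a ∨ i = b := by
    intro i hi h
    by_contra! hcon
    obtain ⟨j, hj, hji⟩ := Finset.mem_image.1 (h (hmτ i))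
    have hj' := Finset.mem_erase.1 hj
    by_cases hja : j = a
    · apply hcon.2
      apply hinj
      · simp [hi, hcon.1]
      · simp [hb, hab.symm]
      · rw [← hji, hja, mab]
    · exact hj'.1 (hinj (by simp [hja, hj'.2]) (by simp [hi, hcon.1]) hji)
  let Q : I → Finset T × Finset I → Prop := fun i R =>
    ∀ j ∈ D, j ≠ i → j ∈ R.2 ∧ ∀ x ∈ R.1, r j (m j) ≤ r j x
  have hcase := fun R (h : Room r R ∧ Rel (τ, D) R) => rel_cases h.2 h.1 hD
  have hQor : ∀ R, Room r R ∧ Rel (τ, D) R → Q a R ∨ Q b R := by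
    rintro ⟨σ, C⟩ h
    have hRd := h.1.1
    rcases hcase _ h with ⟨h1, i, hi, h2⟩ | ⟨h2, x, hx, h1⟩ <;> simp only at h1 h2 <;> subst h1 h2
    · have : Q i (σ, D.erase i) := by
        intro j hj hji
        exact ⟨by simp [hj, hji], fun x hx => hmin j x hx⟩
      have h3 : σ ⊆ (D.erase i).image m := by
        intro z hz
        obtain ⟨j, hj, h⟩ := hRd z
        exact Finset.mem_image.2 ⟨j, hj, (muniq j z hz h).symm⟩
      rcases key i hi h3 with rfl | rfl
      · exact Or.inl this
      · exact Or.inr this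
    · obtain ⟨i, hi, hxi⟩ := hRd x
      have h4 : ∀ z ∈ τ, ∀ k, (∀ x' ∈ insert x τ, r k x ≤ r k x') → ¬ (∀ x' ∈ insert x τ, r k z ≤ r k x') := by
        intro z hz k hk h
        have := hr k (le_antisymm (h x (by simp)) (hk z (by simp [hz])))
        exact hx (this ▸ hz)
      have hQ : Q i (insert x τ, C) := by
        intro j hj hji
        refine ⟨hj, ?_⟩
        by_contra! hcon
        obtain ⟨y, hy, hlt⟩ := hcon
        have hyx : y = x := by
          rcases Finset.mem_insert.1 hy with h | h
          · exact h
          · exact absurd (hmin j y h) (by omega)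
        subst hyx
        have hyj : ∀ x' ∈ insert y τ, r j y ≤ r j x' := by
          intro x' hx'
          rcases Finset.mem_insert.1 hx' with h | h
          · rw [h]
          · have := hmin j x' h; omega
        have hs : τ ⊆ ((C.erase i).erase j).image m := by
          intro z hz
          obtain ⟨k, hk, hkz⟩ := hRd z
          have hki : k ≠ i := by rintro rfl; exact h4 z hz k hxi hkz
          have hkj : k ≠ j := by rintro rfl; exact h4 z hz k hyj hkz
          exact Finset.mem_image.2 ⟨k, by simp [hki, hkj]; exact hk,
            (muniq k z hz (fun y' hy' => hkz y' (by simp [hy']))).symm⟩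
        have := (Finset.card_le_card hs).trans Finset.card_image_le
        rw [Finset.card_erase_of_mem (by simp [hji, hj]), Finset.card_erase_of_mem hi] at this
        have := hτ.card_pos
        simp only at *
        omega
      have h3 : τ ⊆ (C.erase i).image m := by
        intro z hz
        obtain ⟨k, hk, hkz⟩ := hRd z
        have hki : k ≠ i := by rintro rfl; exact h4 z hz k hxi hkz
        exact Finset.mem_image.2 ⟨k, by simp [hki]; exact hk,
            (muniq k z hz (fun y' hy' => hkz y' (by simp [hy']))).symm⟩
      rcases key i hi h3 with rfl | rfl
      · exact Or.inl hQ
      · exact Or.inr hQ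
  have hQand : ∀ R, Room r R ∧ Rel (τ, D) R → Q a R → ¬ Q b R := by
    rintro ⟨σ, C⟩ h ha' hb'
    have hRd := h.1.1
    have hall : ∀ j ∈ D, j ∈ C ∧ ∀ x ∈ σ, r j (m j) ≤ r j x := by
      intro j hj
      by_cases hja : j = a
      · exact hb' j hj (by rw [hja]; exact hab)
      · exact ha' j hj hja
    rcases hcase _ h with ⟨h1, i, hi, h2⟩ | ⟨h2, x, hx, h1⟩ <;> simp only at h1 h2 <;> subst h1 h2
    · exact absurd (hall i hi).1 (by simp)
    · obtain ⟨j, hj, hjx⟩ := hRd x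
      have e := hr j (le_antisymm (hjx (m j) (by simp [hmτ])) ((hall j hj).2 x (by simp)))
      exact hx (e ▸ hmτ j)
  have hQex : ∀ i ∈ D, τ ⊆ (D.erase i).image m → ∃ R, (Room r R ∧ Rel (τ, D) R) ∧ Q i R := by
    intro i hi hsi
    let M : Finset T := Finset.univ.filter (fun y => ∀ j ∈ D, j ≠ i → r j (m j) < r j y)
    by_cases hM : M.Nonempty
    · obtain ⟨x, hxM, hxmax⟩ := Finset.exists_max_image M (r i) hM
      have hxM' : ∀ j ∈ D, j ≠ i → r j (m j) < r j x := by simpa [M] using hxM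
      have hxi : ∀ y ∈ M, r i y ≤ r i (m i) := by
        intro y hy
        have hy' : ∀ j ∈ D, j ≠ i → r j (m j) < r j y := by simpa [M] using hy
        obtain ⟨j, hj, hjx⟩ := hdom y
        by_cases hji : j = i
        · subst hji; exact hjx _ (hmτ _)
        · have h1 := hy' j hj hji
          have h2 := hjx _ (hmτ j)
          omega
      have hxτ : x ∉ τ := by
        intro hx
        obtain ⟨j, hj, hjx⟩ := Finset.mem_image.1 (hsi hx)
        have hj' := Finset.mem_erase.1 hj
        have := hxM' j hj'.2 hj'.1
        rw [hjx] at this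
        omega
      refine ⟨(insert x τ, D), ⟨⟨?_, by simp [hxτ, hD]⟩, by simp [Rel]⟩, ?_⟩
      · intro y
        by_cases hy : y ∈ M
        · refine ⟨i, hi, ?_⟩
          intro x' hx'
          have h1 := hxmax y hy
          rcases Finset.mem_insert.1 hx' with h | h
          · rw [h]; exact h1
          · exact (hxi y hy).trans (hmin i x' h)
        · have : ∃ j ∈ D, j ≠ i ∧ r j y ≤ r j (m j) := by simpa [M] using hy
          obtain ⟨j, hj, hji, hjy⟩ := this
          refine ⟨j, hj, ?_⟩
          intro x' hx'
          rcases Finset.mem_insert.1 hx' with h | h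
          · rw [h]; exact hjy.trans (hxM' j hj hji).le
          · exact hjy.trans (hmin j x' h)
      · intro j hj hji
        refine ⟨hj, ?_⟩
        intro x' hx'
        rcases Finset.mem_insert.1 hx' with h | h
        · rw [h]; exact (hxM' j hj hji).le
        · exact (hmin j x' h)
    · refine ⟨(τ, D.erase i), ⟨⟨?_, by simp [hi, hD]⟩, by simp [Rel, Finset.erase_subset]⟩, ?_⟩
      · intro y
        have hy : y ∉ M := fun h => hM ⟨y, h⟩
        have : ∃ j ∈ D, j ≠ i ∧ r j y ≤ r j (m j) := by simpa [M] using hy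
        obtain ⟨j, hj, hji, hjy⟩ := this
        exact ⟨j, by simp [hji, hj], fun x hx => hjy.trans (hmin j x hx)⟩
      · intro j hj hji
        exact ⟨by simp [hj, hji], fun x hx => hmin j x hx⟩
  have hQuniq : ∀ i ∈ D, ∀ R R', (Room r R ∧ Rel (τ, D) R) → (Room r R' ∧ Rel (τ, D) R') →
      Q i R → Q i R' → R = R' := by
    -- helper: a new element x' from R' vs R
    have aux : ∀ i ∈ D, ∀ R, Room r R → Rel (τ, D) R → ∀ C x', x' ∉ τ → Q i (insert x' τ, C) →
        i ∈ R.2 ∧ ∀ x ∈ R.1, r i x' ≤ r i x := by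
      intro i hi R hR hRel C x' hx' hQ
      obtain ⟨j, hj, hjx⟩ := hR.1 x'
      by_cases hji : j = i
      · subst hji; exact ⟨hj, hjx⟩
      · have h1 := (hQ j (hRel.2 hj) hji).2 x' (by simp)
        have h2 := hjx (m j) (hRel.1 (hmτ j))
        exact absurd (hmτ j) (by rw [hr j (le_antisymm h1 h2)]; exact hx')
    rintro i hi ⟨σ, C⟩ ⟨σ', C'⟩ h h' hQ hQ'
    rcases hcase _ h with ⟨h1, k, hk, h2⟩ | ⟨h2, x, hx, h1⟩ <;> simp only at h1 h2 <;> subst h1 h2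
    · have hki : k = i := by
        by_contra hki
        exact absurd (hQ k hk hki).1 (by simp)
      subst hki
      rcases hcase _ h' with ⟨h1, k', hk', h2⟩ | ⟨h2, x, hx, h1⟩ <;> simp only at h1 h2 <;> subst h1 h2
      · have hki : k' = k := by
          by_contra hki
          exact absurd (hQ' k' hk' hki).1 (by simp)
        rw [hki]
      · exact absurd (aux k hi _ h.1 h.2 _ x hx hQ').1 (by simp)
    · rcases hcase _ h' with ⟨h1, k', hk', h2⟩ | ⟨h2, x', hx', h1⟩ <;> simp only at h1 h2 <;> subst h1 h2
      · have hki : k' = i := by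
          by_contra hki
          exact absurd (hQ' k' hk' hki).1 (by simp)
        subst hki
        exact absurd (aux k' hi _ h'.1 h'.2 _ x hx hQ).1 (by simp)
      · have e1 := (aux i hi _ h'.1 h'.2 _ x hx hQ).2 x' (by simp)
        have e2 := (aux i hi _ h.1 h.2 _ x' hx' hQ').2 x (by simp)
        rw [hr i (le_antisymm e1 e2)]
  obtain ⟨Ra, hRa, hQa⟩ := hQex a ha hsurja
  obtain ⟨Rb, hRb, hQb⟩ := hQex b hb hsurjb
  refine ⟨Ra, Rb, ?_, ?_⟩
  · rintro rfl
    exact hQand _ hRa hQa hQb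
  · intro R
    constructor
    · intro hR
      rcases hQor R hR with h | h
      · exact Or.inl (hQuniq a ha _ _ hR hRa h hQa)
      · exact Or.inr (hQuniq b hb _ _ hR hRb h hQb)
    · rintro (rfl | rfl)
      · exact hRa
      · exact hRb

theorem Door.card {c : T → I} {i0 : I} {d : Finset T × Finset I} (h : Door c i0 d) :
    d.2.card = d.1.card + 1 := by
  rw [h.1, Finset.card_insert_of_notMem h.2.1, Finset.card_image_of_injOn h.2.2]

theorem two_doors (r : I → T → ℕ) (c : T → I) (i0 : I) (R : Finset T × Finset I)
    (hR : Room r R) (hc : R.1.image c ≠ R.2) (d : Finset T × Finset I) (hd : Door c i0 d)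
    (hrel : Rel d R) :
    ∃ d', d ≠ d' ∧ ∀ e, (Door c i0 e ∧ Rel e R) ↔ (e = d ∨ e = d') := by
  classical
  obtain ⟨σ, C⟩ := R
  have hcase := fun e (h : Door c i0 e ∧ Rel e (σ, C)) => rel_cases h.2 hR h.1.card
  have dext : ∀ e e', Door c i0 e → Door c i0 e' → e.1 = e'.1 → e = e' := by
    intro e e' he he' h
    ext1
    · exact h
    · rw [he.1, he'.1, h]
  -- it suffices to give a second door
  suffices h : ∃ d', d.1 ≠ d'.1 ∧ (Door c i0 d' ∧ Rel d' (σ, C)) ∧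
      ∀ e, (Door c i0 e ∧ Rel e (σ, C)) → (e.1 = d.1 ∨ e.1 = d'.1) by
    obtain ⟨d', h1, h2, h3⟩ := h
    refine ⟨d', fun h => h1 (by rw [h]), fun e => ⟨fun he => ?_, ?_⟩⟩
    · rcases h3 e he with h | h
      · exact Or.inl (dext _ _ he.1 hd h)
      · exact Or.inr (dext _ _ he.1 h2.1 h)
    · rintro (rfl | rfl)
      · exact ⟨hd, hrel⟩
      · exact h2
  obtain ⟨τ, D⟩ := d
  obtain ⟨hd1, hd2, hd3⟩ := hd
  simp only at hc hd1 hd2 hd3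
  rcases hcase _ ⟨⟨hd1, hd2, hd3⟩, hrel⟩ with ⟨h1, i, hi, h2⟩ | ⟨h2, x, hx, h1⟩ <;> simp only at h1 h2
  · subst h1
    have hi0 : i ≠ i0 := by
      rintro rfl
      apply hc
      rw [h2, hd1, Finset.erase_insert hd2]
    have : i ∈ σ.image c := by
      rw [hd1] at hi
      exact (Finset.mem_insert.1 hi).resolve_left hi0
    obtain ⟨x, hx, rfl⟩ := Finset.mem_image.1 this
    refine ⟨(σ.erase x, C), ?_, ⟨⟨?_, ?_, ?_⟩, Finset.erase_subset _ _, subset_rfl⟩, ?_⟩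
    · intro h
      simp only at h
      exact Finset.notMem_erase x σ (h ▸ hx)
    · simp only
      rw [h2, hd1]
      ext k
      simp only [Finset.mem_erase, Finset.mem_insert, Finset.mem_image]
      constructor
      · rintro ⟨h1, h | ⟨y, hy, rfl⟩⟩
        · exact Or.inl h
        · exact Or.inr ⟨y, ⟨fun h => h1 (by rw [h]), hy⟩, rfl⟩
      · rintro (h | ⟨y, ⟨hy, hy'⟩, rfl⟩)
        · exact ⟨h ▸ hi0.symm, Or.inl h⟩
        · exact ⟨fun h => hy (hd3 hy' hx h), Or.inr ⟨y, hy', rfl⟩⟩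
    · exact fun h => hd2 (Finset.image_subset_image (Finset.erase_subset _ _) h)
    · exact hd3.mono (by simp)
    · rintro ⟨τ', D'⟩ he
      rcases hcase _ he with ⟨h1, -⟩ | ⟨h3, y, hy, h1⟩
      · exact Or.inl h1.symm
      · right
        simp only at h1 h3 hy ⊢
        have he1 := he.1.1
        simp only at he1
        have hyσ : y ∈ σ := by rw [h1]; simp
        have : c y ∉ C := by
          rw [h3, he1]
          simp only [Finset.mem_insert, Finset.mem_image, not_or, not_exists, not_and]
          refine ⟨fun h => hd2 (Finset.mem_image.2 ⟨y, hyσ, h⟩), fun z hz h => ?_⟩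
          have := hd3 (by rw [h1]; simp [hz]) hyσ h
          exact hy (this ▸ hz)
        have hcy : c y = c x := by
          by_contra hne
          apply this
          rw [h2, hd1]
          simp only [Finset.mem_erase, Finset.mem_insert]
          exact ⟨hne, Or.inr (Finset.mem_image_of_mem _ hyσ)⟩
        rw [← hd3 hyσ hx hcy, h1, Finset.erase_insert hy]
  · subst h1
    subst h2
    have hx0 : c x ≠ i0 := by
      intro h
      apply hc
      rw [Finset.image_insert, h, hd1]
    by_cases hcx : c x ∈ τ.image c
    · obtain ⟨x', hx', hxx⟩ := Finset.mem_image.1 hcx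
      have hne : x ≠ x' := fun h => hx (h ▸ hx')
      refine ⟨((insert x τ).erase x', C), ?_, ⟨⟨?_, ?_, ?_⟩, Finset.erase_subset _ _, subset_rfl⟩, ?_⟩
      · intro h
        simp only at h
        exact Finset.notMem_erase x' _ (h ▸ hx')
      · simp only
        rw [hd1]
        congr 1
        ext k
        simp only [Finset.mem_erase, Finset.mem_insert, Finset.mem_image]
        constructor
        · rintro ⟨y, hy, rfl⟩
          by_cases hyx : y = x'
          · exact ⟨x, ⟨hne, Or.inl rfl⟩, by rw [hyx, hxx]⟩
          · exact ⟨y, ⟨hyx, Or.inr hy⟩, rfl⟩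
        · rintro ⟨y, ⟨hy, rfl | hy'⟩, rfl⟩
          · exact ⟨x', hx', hxx⟩
          · exact ⟨y, hy', rfl⟩
      · simp only [Finset.mem_image, Finset.mem_erase, Finset.mem_insert]
        rintro ⟨y, ⟨hy, rfl | hy'⟩, h⟩
        · exact hx0 h
        · exact hd2 (Finset.mem_image.2 ⟨y, hy', h⟩)
      · intro y hy z hz hyz
        simp only [Finset.coe_erase, Finset.coe_insert, Set.mem_sdiff, Set.mem_insert_iff,
          Finset.mem_coe, Set.mem_singleton_iff] at hy hz
        rcases hy with ⟨rfl | hy, hy'⟩ <;> rcases hz with ⟨rfl | hz, hz'⟩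
        · rfl
        · exact absurd (hd3 hz hx' (by rw [hxx, hyz])) hz'
        · exact absurd (hd3 hy hx' (by rw [hxx, hyz])) hy'
        · exact hd3 hy hz hyz
      · rintro ⟨τ', D'⟩ he
        have he3 := he.1.2.2
        simp only at he3
        rcases hcase _ he with ⟨h1, -⟩ | ⟨h3, y, hy, h1⟩
        · exfalso
          simp only at h1
          rw [← h1] at he3
          exact hne (he3 (by simp) (by simp [hx']) hxx.symm)
        · simp only at h1 h3 hy ⊢
          have hτ' : τ' = (insert x τ).erase y := by rw [h1, Finset.erase_insert hy]
          by_cases hyx : y = x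
          · left; rw [hτ', hyx, Finset.erase_insert hx]
          · by_cases hyx' : y = x'
            · right; rw [hτ', hyx']
            · exfalso
              rw [hτ'] at he3
              exact hne (he3 (by simp [Ne.symm hyx]) (by simp [hx', Ne.symm hyx']) hxx.symm)
    · refine ⟨(insert x τ, insert (c x) C), ?_, ⟨⟨?_, ?_, ?_⟩, subset_rfl, Finset.subset_insert _ _⟩, ?_⟩
      · intro h
        simp only at h
        exact hx (h ▸ Finset.mem_insert_self x τ)
      · simp only
        rw [hd1, Finset.image_insert, Finset.insert_comm]
      · simp only [Finset.image_insert, Finset.mem_insert, not_or]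
        exact ⟨hx0.symm, hd2⟩
      · simp only [Finset.coe_insert]
        refine (Set.injOn_insert (by simpa using hx)).2 ⟨hd3, ?_⟩
        simpa using hcx
      · rintro ⟨τ', D'⟩ he
        rcases hcase _ he with ⟨h1, -⟩ | ⟨h3, y, hy, h1⟩
        · exact Or.inr h1.symm
        · left
          simp only at h1 h3 hy ⊢
          have hτ' : τ' = (insert x τ).erase y := by rw [h1, Finset.erase_insert hy]
          by_cases hyx : y = x
          · rw [hτ', hyx, Finset.erase_insert hx]
          · exfalso
            have he1 := he.1.1
            simp only at he1
            have : c x ∈ D' := by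
              rw [he1, hτ']
              exact Finset.mem_insert_of_mem (Finset.mem_image_of_mem _ (by simp [Ne.symm hyx]))
            rw [← h3, hd1] at this
            exact (Finset.mem_insert.1 this).elim hx0 hcx

theorem exists_colorful [Nonempty T] [Nonempty I] (r : I → T → ℕ)
    (hr : ∀ i, Function.Injective (r i)) (c : T → I) :
    ∃ R, Room r R ∧ R.1.image c = R.2 := by
  classical
  by_contra! hcon
  obtain ⟨i0⟩ := ‹Nonempty I›
  let rooms : Finset (Finset T × Finset I) := Finset.univ.filter (Room r)
  let doors : Finset (Finset T × Finset I) := Finset.univ.filter (fun d => Door c i0 d ∧ Dom r d)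
  have hsum := Finset.sum_card_bipartiteAbove_eq_sum_card_bipartiteBelow (s := doors) (t := rooms)
    (Rel (T := T) (I := I))
  have hright : Even (∑ R ∈ rooms, (Finset.bipartiteBelow Rel doors R).card) := by
    apply Finset.even_sum
    intro R hR
    have hR' : Room r R := by simpa [rooms] using hR
    by_cases h : (Finset.bipartiteBelow Rel doors R).Nonempty
    · obtain ⟨d, hd⟩ := h
      simp only [Finset.bipartiteBelow, doors, Finset.mem_filter, Finset.mem_univ, true_and] at hd
      obtain ⟨d', hne, hd'⟩ := two_doors r c i0 R hR' (hcon R hR') d hd.1.1 hd.2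
      have : Finset.bipartiteBelow Rel doors R = {d, d'} := by
        ext e
        simp only [Finset.bipartiteBelow, doors, Finset.mem_filter, Finset.mem_univ, true_and,
          Finset.mem_insert, Finset.mem_singleton]
        rw [← hd' e]
        constructor
        · rintro ⟨⟨h1, -⟩, h2⟩; exact ⟨h1, h2⟩
        · rintro ⟨h1, h2⟩; exact ⟨⟨h1, dom_of_rel h2 hR'.1⟩, h2⟩
      rw [this, Finset.card_pair hne]
      exact even_two
    · rw [Finset.not_nonempty_iff_eq_empty.1 h]; simp
  have hout : ((∅, {i0}) : Finset T × Finset I) ∈ doors := by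
    simp [doors, Door, Dom]
  have hleft : ¬ Even (∑ d ∈ doors, (Finset.bipartiteAbove Rel rooms d).card) := by
    rw [← Finset.add_sum_erase _ _ hout]
    have h1 : (Finset.bipartiteAbove Rel rooms ((∅, {i0}) : Finset T × Finset I)).card = 1 := by
      obtain ⟨x, -, hx⟩ := Finset.exists_max_image Finset.univ (r i0) (Finset.univ_nonempty (α := T))
      rw [Finset.card_eq_one]
      refine ⟨({x}, {i0}), ?_⟩
      ext ⟨σ, C⟩
      simp only [Finset.bipartiteAbove, rooms, Finset.mem_filter, Finset.mem_univ, true_and,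
          Finset.mem_singleton, Room, Rel, Finset.empty_subset, Prod.mk.injEq]
      constructor
      · rintro ⟨⟨h1, h2⟩, h3⟩
        have hC : C = {i0} := by
          refine h3.antisymm ?_
          obtain ⟨i, hi, -⟩ := h1 x
          have := Finset.mem_singleton.1 (h3 hi)
          subst this
          simpa using hi
        subst hC
        obtain ⟨y, rfl⟩ := Finset.card_eq_one.1 (h2.trans (Finset.card_singleton _))
        refine ⟨?_, rfl⟩
        obtain ⟨i, hi, h⟩ := h1 x
        have hi' := Finset.mem_singleton.1 hi
        subst hi'
        rw [hr i (le_antisymm (h y (by simp)) (hx y (by simp)))]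
      · rintro ⟨rfl, rfl⟩
        refine ⟨⟨?_, by simp⟩, subset_rfl⟩
        intro y
        exact ⟨i0, by simp, by simpa using hx y⟩
    have h2 : Even (∑ d ∈ doors.erase (∅, {i0}), (Finset.bipartiteAbove Rel rooms d).card) := by
      apply Finset.even_sum
      rintro ⟨τ, D⟩ hd
      simp only [doors, Finset.mem_erase, Finset.mem_filter, Finset.mem_univ, true_and] at hd
      obtain ⟨hd0, hd1, hd2⟩ := hd
      have hτ : τ.Nonempty := by
        rw [Finset.nonempty_iff_ne_empty]
        rintro rfl
        apply hd0
        have := hd1.1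
        simp only [Finset.image_empty] at this
        rw [this]; rfl
      obtain ⟨R₁, R₂, hne, h⟩ := two_rooms r hr τ D hτ hd1.card hd2
      have : Finset.bipartiteAbove Rel rooms (τ, D) = {R₁, R₂} := by
        ext R
        simp only [Finset.bipartiteAbove, rooms, Finset.mem_filter, Finset.mem_univ, true_and,
          Finset.mem_insert, Finset.mem_singleton]
        exact h R
      rw [this, Finset.card_pair hne]
      exact even_two
    rw [h1, Nat.even_add]
    simp [h2]
  exact hleft (hsum ▸ hright)

end Scarf

theorem kkm_grid (N : ℕ) (c : (Fin 6 → ℕ) → Fin 6) :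
    ∃ (σ : Finset (Fin 6 → ℕ)) (C : Finset (Fin 6)), σ.Nonempty ∧ (∀ x ∈ σ, ∑ i, x i = N) ∧
      (∀ i ∈ C, ∃ x ∈ σ, c x = i) ∧
      (∀ x ∈ σ, ∀ x' ∈ σ, ∀ k, x k ≤ x' k + 6) ∧ (∀ x ∈ σ, ∀ k, k ∉ C → x k ≤ 6) := by
  classical
  let T := {x : Fin 6 → ℕ // x ∈ Finset.piAntidiag (Finset.univ : Finset (Fin 6)) N}
  have hT : ∀ x : T, ∑ i, x.1 i = N := fun x => by
    have := x.2
    rw [Finset.mem_piAntidiag] at this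
    exact this.1
  have mkT : ∀ x : Fin 6 → ℕ, ∑ i, x i = N → ∃ t : T, t.1 = x := fun x hx =>
    ⟨⟨x, by rw [Finset.mem_piAntidiag]; exact ⟨hx, by simp⟩⟩, rfl⟩
  have : Nonempty T := by
    obtain ⟨t, -⟩ := mkT (Pi.single 0 N) (by simp)
    exact ⟨t⟩
  let e := Fintype.equivFin T
  let r : Fin 6 → T → ℕ := fun i x => x.1 i * Fintype.card T + (e x).1
  have hr : ∀ i, Function.Injective (r i) := by
    intro i x y h
    have h1 : (r i x) % Fintype.card T = (r i y) % Fintype.card T := by rw [h]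
    simp only [r] at h1
    rw [Nat.mul_add_mod', Nat.mul_add_mod', Nat.mod_eq_of_lt (e x).2, Nat.mod_eq_of_lt (e y).2] at h1
    exact e.injective (Fin.ext h1)
  have hle : ∀ i x y, r i x ≤ r i y → x.1 i ≤ y.1 i := by
    intro i x y h
    by_contra! hlt
    have h1 : (y.1 i + 1) * Fintype.card T ≤ x.1 i * Fintype.card T := Nat.mul_le_mul_right _ hlt
    have h2 := (e y).2
    simp only [r] at h
    rw [add_mul] at h1
    omega
  obtain ⟨⟨σ, C⟩, ⟨hdom, hcard⟩, hcol⟩ := Scarf.exists_colorful r hr (fun x => c x.1)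
  simp only at hcard hcol
  have hCne : C.Nonempty := by
    obtain ⟨i, hi, -⟩ := hdom (Classical.arbitrary T)
    exact ⟨i, hi⟩
  have hσne : σ.Nonempty := by
    rw [← Finset.card_pos, hcard]; exact hCne.card_pos
  have hm : ∀ i, ∃ x ∈ σ, ∀ y ∈ σ, x.1 i ≤ y.1 i := fun i =>
    Finset.exists_min_image σ (fun x => x.1 i) hσne
  choose m hmσ hmin using hm
  let m' : Fin 6 → ℕ := fun k => if k ∈ C then (m k).1 k else 0
  let u : Fin 6 → ℕ := fun k => if k ∈ C then (m k).1 k + 1 else 0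
  have hu : N < ∑ k, u k := by
    by_contra! hcon
    obtain ⟨j0, hj0⟩ := hCne
    obtain ⟨t, ht⟩ := mkT (u + Pi.single j0 (N - ∑ k, u k)) (by
      simp [Finset.sum_add_distrib]; omega)
    obtain ⟨i, hi, h⟩ := hdom t
    have h1 := hle _ _ _ (h (m i) (hmσ i))
    rw [ht] at h1
    simp only at hi
    simp [u, hi] at h1
    omega
  have hum : ∑ k, u k ≤ ∑ k, m' k + 6 := by
    have : ∑ k, u k ≤ ∑ k : Fin 6, (m' k + 1) := by
      apply Finset.sum_le_sum
      intro k _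
      simp only [u, m']
      split_ifs <;> omega
    simpa [Finset.sum_add_distrib] using this
  have hlow : ∀ x ∈ σ, ∀ k, m' k ≤ x.1 k := by
    intro x hx k
    simp only [m']
    split_ifs
    · exact hmin k x hx
    · omega
  have hup : ∀ x ∈ σ, ∀ k, x.1 k ≤ m' k + 6 := by
    intro x hx k
    have h1 := hT x
    rw [← Finset.add_sum_erase _ _ (Finset.mem_univ k)] at h1
    have h3 := Finset.add_sum_erase _ m' (Finset.mem_univ k)
    have h2 : ∑ i ∈ Finset.univ.erase k, m' i ≤ ∑ i ∈ Finset.univ.erase k, x.1 i :=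
      Finset.sum_le_sum (fun i _ => hlow x hx i)
    omega
  refine ⟨σ.image Subtype.val, C, hσne.image _, ?_, ?_, ?_, ?_⟩
  · intro x hx
    obtain ⟨t, -, rfl⟩ := Finset.mem_image.1 hx
    exact hT t
  · intro i hi
    rw [← hcol] at hi
    obtain ⟨t, ht, h⟩ := Finset.mem_image.1 hi
    exact ⟨t.1, Finset.mem_image_of_mem _ ht, h⟩
  · intro x hx x' hx' k
    obtain ⟨t, ht, rfl⟩ := Finset.mem_image.1 hx
    obtain ⟨t', ht', rfl⟩ := Finset.mem_image.1 hx'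
    have := hup t ht k
    have := hlow t' ht' k
    omega
  · intro x hx k hk
    obtain ⟨t, ht, rfl⟩ := Finset.mem_image.1 hx
    have := hup t ht k
    simpa [m', hk] using this

theorem kkm (B : Fin 6 → Set (Fin 6 → ℝ)) (hcl : ∀ i, IsClosed (B i))
    (hcov : ∀ x ∈ stdSimplex ℝ (Fin 6), ∃ i, x ∈ B i)
    (hbd : ∀ x ∈ stdSimplex ℝ (Fin 6), ∀ i, x i = 0 → x ∈ B i) :
    ∃ x ∈ stdSimplex ℝ (Fin 6), ∀ i, x ∈ B i := by
  classical
  have hne : ∀ i, (B i).Nonempty := by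
    intro i
    refine ⟨Pi.single (i + 1) 1, hbd _ (single_mem_stdSimplex ℝ (i+1)) i ?_⟩
    rw [Pi.single_eq_of_ne]
    revert i; decide
  have happ : ∀ n : ℕ, ∃ p ∈ stdSimplex ℝ (Fin 6), ∀ i, Metric.infDist p (B i) ≤ 6 / ((n : ℝ) + 1) := by
    intro n
    let N := n + 1
    have hN : (0 : ℝ) < (n : ℝ) + 1 := by positivity
    let g : (Fin 6 → ℕ) → (Fin 6 → ℝ) := fun x k => (x k : ℝ) / ((n : ℝ) + 1)
    have hg : ∀ x : Fin 6 → ℕ, ∑ i, x i = N → g x ∈ stdSimplex ℝ (Fin 6) := by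
      intro x hx
      refine ⟨fun k => by positivity, ?_⟩
      simp only [g]
      rw [← Finset.sum_div, ← Nat.cast_sum, hx]
      simp only [N]
      push_cast
      exact div_self hN.ne'
    let c : (Fin 6 → ℕ) → Fin 6 := fun x => if h : ∃ i, g x ∈ B i then h.choose else 0
    have hc : ∀ x : Fin 6 → ℕ, ∑ i, x i = N → g x ∈ B (c x) := by
      intro x hx
      have h := hcov _ (hg x hx)
      simp only [c, dif_pos h]
      exact h.choose_spec
    obtain ⟨σ, C, ⟨x, hx⟩, hσ, hC, hclose, hsmall⟩ := kkm_grid N c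
    refine ⟨g x, hg x (hσ x hx), fun i => ?_⟩
    by_cases hi : i ∈ C
    · obtain ⟨y, hy, rfl⟩ := hC i hi
      refine (Metric.infDist_le_dist_of_mem (hc y (hσ y hy))).trans ?_
      rw [dist_pi_le_iff (by positivity)]
      intro k
      simp only [g]
      rw [Real.dist_eq, ← sub_div, abs_div, abs_of_pos hN]
      gcongr
      have h1 : (x k : ℝ) ≤ y k + 6 := by exact_mod_cast hclose x hx y hy k
      have h2 : (y k : ℝ) ≤ x k + 6 := by exact_mod_cast hclose y hy x hx k
      rw [abs_le]; constructor <;> linarith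
    · have hxi := hsmall x hx i hi
      have hi1 : i + 1 ≠ i := by
        clear hxi hi
        revert i; decide
      let z : Fin 6 → ℕ := Function.update (Function.update x i 0) (i + 1) (x (i + 1) + x i)
      have hz : ∑ k, z k = N := by
        have h0 := hσ x hx
        have e1 : ∀ w : Fin 6 → ℕ, ∑ k, w k = w (i+1) + (w i + ∑ k ∈ (Finset.univ.erase (i+1)).erase i, w k) := by
          intro w
          rw [Finset.add_sum_erase _ _ (by simp [hi1.symm]), Finset.add_sum_erase _ _ (Finset.mem_univ _)]
        rw [e1] at h0 ⊢
        have e2 : ∑ k ∈ (Finset.univ.erase (i+1)).erase i, z k = ∑ k ∈ (Finset.univ.erase (i+1)).erase i, x k := by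
          apply Finset.sum_congr rfl
          intro k hk
          simp only [Finset.mem_erase] at hk
          simp [z, hk.1, hk.2.1]
        rw [e2]
        simp only [z, Function.update_self, Function.update_of_ne hi1.symm]
        omega
      have hzB : g z ∈ B i := by
        apply hbd _ (hg z hz)
        simp [g, z]
      refine (Metric.infDist_le_dist_of_mem hzB).trans ?_
      rw [dist_pi_le_iff (by positivity)]
      intro k
      simp only [g]
      rw [Real.dist_eq, ← sub_div, abs_div, abs_of_pos hN]
      gcongr
      by_cases h1 : k = i + 1
      · subst h1
        simp [z]; exact hxi
      · by_cases h2 : k = i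
        · subst h2
          simp [z]; exact hxi
        · simp [z, h1, h2]
  have hcont : Continuous (fun p : Fin 6 → ℝ => ∑ i, Metric.infDist p (B i)) := by
    apply continuous_finsetSum
    intro i _
    exact Metric.continuous_infDist_pt _
  obtain ⟨p, hp, hmin⟩ := (isCompact_stdSimplex ℝ (Fin 6)).exists_isMinOn
    ⟨_, single_mem_stdSimplex ℝ (0 : Fin 6)⟩ hcont.continuousOn
  refine ⟨p, hp, ?_⟩
  have h0 : ∑ i, Metric.infDist p (B i) ≤ 0 := by
    apply le_of_forall_pos_le_add
    intro ε hε
    obtain ⟨n, hn⟩ := exists_nat_gt (36 / ε)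
    obtain ⟨q, hq, hqB⟩ := happ n
    have h1 : ∑ i, Metric.infDist p (B i) ≤ ∑ i, Metric.infDist q (B i) := hmin hq
    have h2 : ∑ i, Metric.infDist q (B i) ≤ ∑ i : Fin 6, 6 / ((n : ℝ) + 1) :=
      Finset.sum_le_sum (fun i _ => hqB i)
    have h3 : ∑ i : Fin 6, 6 / ((n : ℝ) + 1) = 36 / ((n : ℝ) + 1) := by
      simp; ring
    have h4 : 36 / ((n : ℝ) + 1) ≤ ε := by
      rw [div_le_iff₀ (by positivity)]
      rw [div_lt_iff₀ hε] at hn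
      nlinarith
    linarith
  intro i
  have h1 : Metric.infDist p (B i) = 0 := by
    have := (Finset.sum_eq_zero_iff_of_nonneg (s := Finset.univ) (f := fun i => Metric.infDist p (B i))
      (fun i _ => Metric.infDist_nonneg)).1
      (le_antisymm h0 (Finset.sum_nonneg (fun i _ => Metric.infDist_nonneg)))
    exact this i (Finset.mem_univ i)
  exact ((hcl i).mem_iff_infDist_zero (hne i)).2 h1

noncomputable def HH (ρ a b : ℝ) (p : Plane) : ℝ :=
  ρ * Real.cos ((b - a) / 2) - (p 0 * Real.cos ((a + b) / 2) + p 1 * Real.sin ((a + b) / 2))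

noncomputable def cpt (ρ s : ℝ) : Plane := !₂[ρ * Real.cos s, ρ * Real.sin s]

theorem HH_cpt (ρ a b s : ℝ) :
    HH ρ a b (cpt ρ s) = 2 * ρ * (Real.sin ((s - a) / 2) * Real.sin ((s - b) / 2)) := by
  have h1 : (b - a) / 2 = (s - a) / 2 - (s - b) / 2 := by ring
  have h2 : Real.cos s * Real.cos ((a + b) / 2) + Real.sin s * Real.sin ((a + b) / 2)
      = Real.cos ((s - a) / 2 + (s - b) / 2) := by
    rw [← Real.cos_sub]; congr 1; ring
  have h3 : HH ρ a b (cpt ρ s) = ρ * Real.cos ((b - a) / 2) - ρ * (Real.cos s * Real.cos ((a + b) / 2)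
      + Real.sin s * Real.sin ((a + b) / 2)) := by
    simp [HH, cpt]; ring
  rw [h3, h2, h1, Real.cos_sub, Real.cos_add]; ring

theorem HH_neg {ρ a b s : ℝ} (hρ : 0 < ρ) (ha : 0 ≤ a) (hab : a ≤ b) (hb : b ≤ 2 * Real.pi)
    (hs0 : 0 ≤ s) (hs : s ≤ 2 * Real.pi) (h : HH ρ a b (cpt ρ s) < 0) : a < s ∧ s < b := by
  rw [HH_cpt] at h
  by_contra hcon
  rcases (not_and_or.1 hcon) with h1 | h1 <;> push Not at h1
  · have e1 : Real.sin ((s - a) / 2) ≤ 0 := Real.sin_nonpos_of_nonpos_of_neg_pi_le (by linarith) (by linarith)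
    have e2 : Real.sin ((s - b) / 2) ≤ 0 := Real.sin_nonpos_of_nonpos_of_neg_pi_le (by linarith) (by linarith)
    have := mul_nonneg_of_nonpos_of_nonpos e1 e2
    have : 0 ≤ 2 * ρ * (Real.sin ((s - a) / 2) * Real.sin ((s - b) / 2)) := by positivity
    linarith
  · have e1 : 0 ≤ Real.sin ((s - a) / 2) := Real.sin_nonneg_of_nonneg_of_le_pi (by linarith) (by linarith)
    have e2 : 0 ≤ Real.sin ((s - b) / 2) := Real.sin_nonneg_of_nonneg_of_le_pi (by linarith) (by linarith)
    have : 0 ≤ 2 * ρ * (Real.sin ((s - a) / 2) * Real.sin ((s - b) / 2)) := by positivity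
    linarith

theorem HH_pos {ρ a b s : ℝ} (hρ : 0 < ρ) (ha : 0 ≤ a) (hb : b ≤ 2 * Real.pi)
    (hs0 : 0 ≤ s) (hs : s ≤ 2 * Real.pi) (h : 0 < HH ρ a b (cpt ρ s)) : s < a ∨ b < s := by
  rw [HH_cpt] at h
  by_contra! hcon
  have e1 : 0 ≤ Real.sin ((s - a) / 2) := Real.sin_nonneg_of_nonneg_of_le_pi (by linarith) (by linarith)
  have e2 : Real.sin ((s - b) / 2) ≤ 0 := Real.sin_nonpos_of_nonpos_of_neg_pi_le (by linarith) (by linarith)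
  have h3 := mul_nonpos_of_nonneg_of_nonpos e1 e2
  have : 2 * ρ * (Real.sin ((s - a) / 2) * Real.sin ((s - b) / 2)) ≤ 0 :=
    mul_nonpos_of_nonneg_of_nonpos (by positivity) h3
  linarith

theorem HH_left (ρ a b : ℝ) : HH ρ a b (cpt ρ a) = 0 := by rw [HH_cpt]; simp
theorem HH_right (ρ a b : ℝ) : HH ρ a b (cpt ρ b) = 0 := by rw [HH_cpt]; simp

theorem HH_ray (ρ a b l : ℝ) (p q : Plane) :
    HH ρ a b (p + l • (p - q)) = (1 + l) * HH ρ a b p - l * HH ρ a b q := by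
  simp [HH]; ring

theorem HH_comb (ρ a b : ℝ) (p q : Plane) (u v : ℝ) (huv : u + v = 1) :
    HH ρ a b (u • p + v • q) = u * HH ρ a b p + v * HH ρ a b q := by
  have : v = 1 - u := by linarith
  subst this
  simp [HH]; ring

theorem HH_cont (ρ a b : ℝ) : Continuous (HH ρ a b) := by
  unfold HH; fun_prop

theorem circle_param (ρ : ℝ) (u : Plane) (hu : ‖u‖ = ρ) :
    ∃ s, 0 ≤ s ∧ s ≤ 2 * Real.pi ∧ u = cpt ρ s := by
  let z : ℂ := ⟨u 0, u 1⟩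
  have hz : ‖z‖ = ρ := by
    rw [← hu, EuclideanSpace.norm_eq, Complex.norm_def, Complex.normSq_apply]
    simp [z, Fin.sum_univ_two, sq]
  have h1 : ρ * Real.cos z.arg = u 0 := by rw [← hz, Complex.norm_mul_cos_arg]
  have h2 : ρ * Real.sin z.arg = u 1 := by rw [← hz, Complex.norm_mul_sin_arg]
  have h3 := Complex.neg_pi_lt_arg z
  have h4 := Complex.arg_le_pi z
  have hpi := Real.pi_pos
  by_cases h : 0 ≤ z.arg
  · refine ⟨z.arg, h, by linarith, ?_⟩
    ext i; fin_cases i <;> simp [cpt, h1, h2]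
  · refine ⟨z.arg + 2 * Real.pi, by linarith, by linarith, ?_⟩
    ext i; fin_cases i <;> simp [cpt, h1, h2]

theorem exit_circle (ρ : ℝ) (p q : Plane) (hp : ‖p‖ < ρ) (hpq : p ≠ q) :
    ∃ l : ℝ, 0 ≤ l ∧ ∃ s, 0 ≤ s ∧ s ≤ 2 * Real.pi ∧ p + l • (p - q) = cpt ρ s := by
  have hd : 0 < ‖p - q‖ := norm_pos_iff.2 (sub_ne_zero.2 hpq)
  let f : ℝ → ℝ := fun l => ‖p + l • (p - q)‖
  have hf : Continuous f := by fun_prop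
  let L := 2 * ρ / ‖p - q‖
  have hρ : 0 ≤ ρ := (norm_nonneg p).trans hp.le
  have hL : 0 ≤ L := by positivity
  have hfL : ρ ≤ f L := by
    have h1 : ‖L • (p - q)‖ = 2 * ρ := by
      rw [norm_smul, Real.norm_of_nonneg hL]
      exact div_mul_cancel₀ _ hd.ne'
    have h2 : ‖L • (p - q)‖ ≤ ‖p + L • (p - q)‖ + ‖p‖ := by
      calc ‖L • (p - q)‖ = ‖(p + L • (p - q)) - p‖ := by congr 1; abel
        _ ≤ _ := norm_sub_le _ _
    simp only [f]; linarith
  have hf0 : f 0 ≤ ρ := by simpa [f] using hp.le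
  obtain ⟨l, hl, hl'⟩ := intermediate_value_Icc hL hf.continuousOn ⟨hf0, hfL⟩
  exact ⟨l, hl.1, circle_param ρ _ hl'⟩

theorem exit_pair (ρ a b a' b' : ℝ) (p q : Plane) (hp : ‖p‖ < ρ)
    (hq : HH ρ a b q = 0) (hq' : HH ρ a' b' q = 0) (hne : HH ρ a b p ≠ 0) :
    ∃ s, 0 ≤ s ∧ s ≤ 2 * Real.pi ∧
      ((HH ρ a b p < 0 → HH ρ a b (cpt ρ s) < 0) ∧ (0 < HH ρ a b p → 0 < HH ρ a b (cpt ρ s))) ∧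
      ((HH ρ a' b' p < 0 → HH ρ a' b' (cpt ρ s) < 0) ∧
        (0 < HH ρ a' b' p → 0 < HH ρ a' b' (cpt ρ s))) := by
  have hpq : p ≠ q := by rintro rfl; exact hne hq
  obtain ⟨l, hl, s, hs0, hs, h⟩ := exit_circle ρ p q hp hpq
  refine ⟨s, hs0, hs, ⟨fun h' => ?_, fun h' => ?_⟩, ⟨fun h' => ?_, fun h' => ?_⟩⟩ <;>
    rw [← h, HH_ray] <;> first | rw [hq] | rw [hq']
  all_goals nlinarith

noncomputable def D0 (ρ : ℝ) (x : Fin 6 → ℝ) (p : Plane) : ℝ :=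
  HH ρ 0 (2 * Real.pi * (x 0 + x 1 + x 2)) p
noncomputable def D1 (ρ : ℝ) (x : Fin 6 → ℝ) (p : Plane) : ℝ :=
  HH ρ (2 * Real.pi * x 0) (2 * Real.pi * (x 0 + x 1 + x 2 + x 3)) p
noncomputable def D2 (ρ : ℝ) (x : Fin 6 → ℝ) (p : Plane) : ℝ :=
  HH ρ (2 * Real.pi * (x 0 + x 1)) (2 * Real.pi * (x 0 + x 1 + x 2 + x 3 + x 4)) p

theorem D0_cont (ρ : ℝ) (p : Plane) : Continuous (fun x => D0 ρ x p) := by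
  unfold D0 HH; fun_prop
theorem D1_cont (ρ : ℝ) (p : Plane) : Continuous (fun x => D1 ρ x p) := by
  unfold D1 HH; fun_prop
theorem D2_cont (ρ : ℝ) (p : Plane) : Continuous (fun x => D2 ρ x p) := by
  unfold D2 HH; fun_prop

def condi (ρ : ℝ) (x : Fin 6 → ℝ) (p : Plane) : Fin 6 → Prop :=
  ![D0 ρ x p < 0 ∧ 0 < D1 ρ x p, D1 ρ x p < 0 ∧ 0 < D2 ρ x p, D0 ρ x p < 0 ∧ D2 ρ x p < 0,
    0 < D0 ρ x p ∧ D1 ρ x p < 0, 0 < D1 ρ x p ∧ D2 ρ x p < 0, 0 < D0 ρ x p ∧ 0 < D2 ρ x p]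

theorem cond_open (ρ : ℝ) (p : Plane) (i : Fin 6) : IsOpen {x | condi ρ x p i} := by
  have c0 := D0_cont ρ p
  have c1 := D1_cont ρ p
  have c2 := D2_cont ρ p
  have z : Continuous (fun _ : Fin 6 → ℝ => (0 : ℝ)) := continuous_const
  fin_cases i
  · exact (isOpen_lt c0 z).inter (isOpen_lt z c1)
  · exact (isOpen_lt c1 z).inter (isOpen_lt z c2)
  · exact (isOpen_lt c0 z).inter (isOpen_lt c2 z)
  · exact (isOpen_lt z c0).inter (isOpen_lt c1 z)
  · exact (isOpen_lt z c1).inter (isOpen_lt c2 z)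
  · exact (isOpen_lt z c0).inter (isOpen_lt z c2)

theorem cond_bd {ρ : ℝ} (hρ : 0 < ρ) {x : Fin 6 → ℝ} (hx : x ∈ stdSimplex ℝ (Fin 6)) {p : Plane}
    (hp : ‖p‖ < ρ) {i : Fin 6} (hi : x i = 0) : ¬ condi ρ x p i := by
  have hpi := Real.pi_pos
  have hn := hx.1
  have hs := hx.2
  rw [Fin.sum_univ_six] at hs
  have n0 := mul_nonneg hpi.le (hn 0)
  have n1 := mul_nonneg hpi.le (hn 1)
  have n2 := mul_nonneg hpi.le (hn 2)
  have n3 := mul_nonneg hpi.le (hn 3)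
  have n4 := mul_nonneg hpi.le (hn 4)
  have n5 := mul_nonneg hpi.le (hn 5)
  have hsum : Real.pi * x 0 + Real.pi * x 1 + Real.pi * x 2 + Real.pi * x 3 + Real.pi * x 4
    + Real.pi * x 5 = Real.pi := by
    have := congrArg (fun t => Real.pi * t) hs
    linarith
  have hL0 := HH_left ρ 0 (2 * Real.pi * (x 0 + x 1 + x 2))
  have hR0 := HH_right ρ 0 (2 * Real.pi * (x 0 + x 1 + x 2))
  have hL1 := HH_left ρ (2 * Real.pi * x 0) (2 * Real.pi * (x 0 + x 1 + x 2 + x 3))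
  have hR1 := HH_right ρ (2 * Real.pi * x 0) (2 * Real.pi * (x 0 + x 1 + x 2 + x 3))
  have hL2 := HH_left ρ (2 * Real.pi * (x 0 + x 1)) (2 * Real.pi * (x 0 + x 1 + x 2 + x 3 + x 4))
  have hR2 := HH_right ρ (2 * Real.pi * (x 0 + x 1)) (2 * Real.pi * (x 0 + x 1 + x 2 + x 3 + x 4))
  have e0 : ∀ s, 0 ≤ s → s ≤ 2 * Real.pi → D0 ρ x (cpt ρ s) < 0 → _ := fun s h1 h2 h =>
    HH_neg hρ le_rfl (by linarith) (by linarith) h1 h2 h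
  have e1 : ∀ s, 0 ≤ s → s ≤ 2 * Real.pi → D1 ρ x (cpt ρ s) < 0 → _ := fun s h1 h2 h =>
    HH_neg hρ (by linarith) (by linarith) (by linarith) h1 h2 h
  have e2 : ∀ s, 0 ≤ s → s ≤ 2 * Real.pi → D2 ρ x (cpt ρ s) < 0 → _ := fun s h1 h2 h =>
    HH_neg hρ (by linarith) (by linarith) (by linarith) h1 h2 h
  have f0 : ∀ s, 0 ≤ s → s ≤ 2 * Real.pi → 0 < D0 ρ x (cpt ρ s) → _ := fun s h1 h2 h =>
    HH_pos hρ le_rfl (by linarith) h1 h2 h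
  have f1 : ∀ s, 0 ≤ s → s ≤ 2 * Real.pi → 0 < D1 ρ x (cpt ρ s) → _ := fun s h1 h2 h =>
    HH_pos hρ (by linarith) (by linarith) h1 h2 h
  have f2 : ∀ s, 0 ≤ s → s ≤ 2 * Real.pi → 0 < D2 ρ x (cpt ρ s) → _ := fun s h1 h2 h =>
    HH_pos hρ (by linarith) (by linarith) h1 h2 h
  rintro hc
  fin_cases i
  · obtain ⟨ha, hb⟩ : D0 ρ x p < 0 ∧ 0 < D1 ρ x p := hc
    have hi : x 0 = 0 := hi
    have hpx : Real.pi * x 0 = 0 := by rw [hi, mul_zero]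
    have hq : D1 ρ x (cpt ρ 0) = 0 := by
      have e : cpt ρ 0 = cpt ρ (2 * Real.pi * x 0) := by rw [hi]; simp
      rw [e]; exact hL1
    obtain ⟨s, hs0, hs1, k1, k2⟩ := exit_pair ρ _ _ _ _ p _ hp hL0 hq ha.ne
    have := e0 s hs0 hs1 (k1.1 ha)
    rcases f1 s hs0 hs1 (k2.2 hb) with h | h <;> linarith
  · obtain ⟨ha, hb⟩ : D1 ρ x p < 0 ∧ 0 < D2 ρ x p := hc
    have hi : x 1 = 0 := hi
    have hpx : Real.pi * x 1 = 0 := by rw [hi, mul_zero]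
    have hq : D2 ρ x (cpt ρ (2 * Real.pi * x 0)) = 0 := by
      have e : (2 * Real.pi * x 0) = 2 * Real.pi * (x 0 + x 1) := by linarith
      rw [e]; exact hL2
    obtain ⟨s, hs0, hs1, k1, k2⟩ := exit_pair ρ _ _ _ _ p _ hp hL1 hq ha.ne
    have := e1 s hs0 hs1 (k1.1 ha)
    rcases f2 s hs0 hs1 (k2.2 hb) with h | h <;> linarith
  · obtain ⟨ha, hb⟩ : D0 ρ x p < 0 ∧ D2 ρ x p < 0 := hc
    have hi : x 2 = 0 := hi
    have hpx : Real.pi * x 2 = 0 := by rw [hi, mul_zero]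
    have hq : D2 ρ x (cpt ρ (2 * Real.pi * (x 0 + x 1 + x 2))) = 0 := by
      have e : (2 * Real.pi * (x 0 + x 1 + x 2)) = 2 * Real.pi * (x 0 + x 1) := by linarith
      rw [e]; exact hL2
    obtain ⟨s, hs0, hs1, k1, k2⟩ := exit_pair ρ _ _ _ _ p _ hp hR0 hq ha.ne
    have h1 := e0 s hs0 hs1 (k1.1 ha)
    have h2 := e2 s hs0 hs1 (k2.1 hb)
    linarith
  · obtain ⟨ha, hb⟩ : 0 < D0 ρ x p ∧ D1 ρ x p < 0 := hc
    have hi : x 3 = 0 := hi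
    have hpx : Real.pi * x 3 = 0 := by rw [hi, mul_zero]
    have hq : D1 ρ x (cpt ρ (2 * Real.pi * (x 0 + x 1 + x 2))) = 0 := by
      have e : (2 * Real.pi * (x 0 + x 1 + x 2)) = 2 * Real.pi * (x 0 + x 1 + x 2 + x 3) := by linarith
      rw [e]; exact hR1
    obtain ⟨s, hs0, hs1, k1, k2⟩ := exit_pair ρ _ _ _ _ p _ hp hR0 hq ha.ne'
    have h2 := e1 s hs0 hs1 (k2.1 hb)
    rcases f0 s hs0 hs1 (k1.2 ha) with h | h <;> linarith
  · obtain ⟨ha, hb⟩ : 0 < D1 ρ x p ∧ D2 ρ x p < 0 := hc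
    have hi : x 4 = 0 := hi
    have hpx : Real.pi * x 4 = 0 := by rw [hi, mul_zero]
    have hq : D2 ρ x (cpt ρ (2 * Real.pi * (x 0 + x 1 + x 2 + x 3))) = 0 := by
      have e : (2 * Real.pi * (x 0 + x 1 + x 2 + x 3)) = 2 * Real.pi * (x 0 + x 1 + x 2 + x 3 + x 4) := by linarith
      rw [e]; exact hR2
    obtain ⟨s, hs0, hs1, k1, k2⟩ := exit_pair ρ _ _ _ _ p _ hp hR1 hq ha.ne'
    have h2 := e2 s hs0 hs1 (k2.1 hb)
    rcases f1 s hs0 hs1 (k1.2 ha) with h | h <;> linarith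
  · obtain ⟨ha, hb⟩ : 0 < D0 ρ x p ∧ 0 < D2 ρ x p := hc
    have hi : x 5 = 0 := hi
    have hpx : Real.pi * x 5 = 0 := by rw [hi, mul_zero]
    have hq : D2 ρ x (cpt ρ 0) = 0 := by
      have : cpt ρ 0 = cpt ρ (2 * Real.pi * (x 0 + x 1 + x 2 + x 3 + x 4)) := by
        have : x 0 + x 1 + x 2 + x 3 + x 4 = 1 := by linarith
        rw [this]; simp [cpt]
      rw [this]; exact hR2
    obtain ⟨s, hs0, hs1, k1, k2⟩ := exit_pair ρ _ _ _ _ p _ hp hL0 hq ha.ne'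
    rcases f0 s hs0 hs1 (k1.2 ha) with h | h <;>
    rcases f2 s hs0 hs1 (k2.2 hb) with h' | h' <;> linarith

theorem no_both_s13 {ρ : ℝ} (hρ : 0 < ρ) {x : Fin 6 → ℝ} (hx : x ∈ stdSimplex ℝ (Fin 6)) {p q : Plane}
    (hp : ‖p‖ < ρ) (hp0 : 0 < D0 ρ x p) (hp1 : D1 ρ x p < 0) (hp2 : 0 < D2 ρ x p)
    (hq0 : D0 ρ x q < 0) (hq1 : 0 < D1 ρ x q) (hq2 : D2 ρ x q < 0) : False := by
  have hpi := Real.pi_pos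
  have hn := hx.1
  have hs := hx.2
  rw [Fin.sum_univ_six] at hs
  have n0 := mul_nonneg hpi.le (hn 0)
  have n1 := mul_nonneg hpi.le (hn 1)
  have n2 := mul_nonneg hpi.le (hn 2)
  have n3 := mul_nonneg hpi.le (hn 3)
  have n4 := mul_nonneg hpi.le (hn 4)
  have n5 := mul_nonneg hpi.le (hn 5)
  have hsum : Real.pi * x 0 + Real.pi * x 1 + Real.pi * x 2 + Real.pi * x 3 + Real.pi * x 4
    + Real.pi * x 5 = Real.pi := by
    have := congrArg (fun t => Real.pi * t) hs
    linarith
  have hpq : p ≠ q := by rintro rfl; linarith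
  obtain ⟨l, hl, s, hs0, hs1, h⟩ := exit_circle ρ p q hp hpq
  have k0 : 0 < D0 ρ x (cpt ρ s) := by
    unfold D0 at *; rw [← h, HH_ray]; nlinarith
  have k1 : D1 ρ x (cpt ρ s) < 0 := by
    unfold D1 at *; rw [← h, HH_ray]; nlinarith
  have k2 : 0 < D2 ρ x (cpt ρ s) := by
    unfold D2 at *; rw [← h, HH_ray]; nlinarith
  have h1 := HH_neg hρ (by linarith) (by linarith) (by linarith) hs0 hs1 k1
  rcases HH_pos hρ le_rfl (by linarith) hs0 hs1 k0 with h | h <;>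
  rcases HH_pos hρ (by linarith) (by linarith) hs0 hs1 k2 with h' | h' <;> linarith

theorem isLine_HH (ρ a b : ℝ) : IsLine {p | HH ρ a b p = 0} := by
  set C := Real.cos ((a + b) / 2) with hC
  set S := Real.sin ((a + b) / 2) with hS
  set K := ρ * Real.cos ((b - a) / 2) with hK
  have hCS : S ^ 2 + C ^ 2 = 1 := Real.sin_sq_add_cos_sq _
  refine ⟨!₂[K * C, K * S], !₂[-S, C], ?_, ?_⟩
  · intro h
    have h0 := congrArg (fun v : Plane => v 0) h
    have h1 := congrArg (fun v : Plane => v 1) h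
    simp at h0 h1
    rw [h0, h1] at hCS
    norm_num at hCS
  · ext p
    simp only [Set.mem_setOf_eq, HH, ← hC, ← hS, ← hK]
    constructor
    · intro h
      refine ⟨-S * p 0 + C * p 1, ?_⟩
      ext i
      fin_cases i
      · simp
        linear_combination -C * h - p 0 * hCS
      · simp
        linear_combination -S * h - p 1 * hCS
    · rintro ⟨t, rfl⟩
      simp
      linear_combination -K * hCS

theorem HH_sign (ρ a b : ℝ) (S : Set Plane) (hS : IsPreconnected S) (h : ∀ p ∈ S, HH ρ a b p ≠ 0) :
    (∀ p ∈ S, 0 < HH ρ a b p) ∨ (∀ p ∈ S, HH ρ a b p < 0) := by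
  by_contra! hcon
  obtain ⟨⟨p, hp, h1⟩, q, hq, h2⟩ := hcon
  obtain ⟨z, hz, hz'⟩ := hS.intermediate_value hp hq (HH_cont ρ a b).continuousOn ⟨h1, h2⟩
  exact h z hz hz'

theorem hull_neg {ρ a b : ℝ} {A : Set Plane} (h : ∀ p ∈ A, HH ρ a b p < 0) {z : Plane}
    (hz : z ∈ convexHull ℝ A) : HH ρ a b z < 0 := by
  have hc : Convex ℝ {p | HH ρ a b p < 0} := by
    intro p hp q hq u v hu hv huv
    simp only [Set.mem_setOf_eq] at *
    rw [HH_comb _ _ _ _ _ _ _ huv]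
    rcases hu.eq_or_lt with rfl | hu'
    · have : v = 1 := by linarith
      subst this; linarith
    · nlinarith
  exact convexHull_min h hc hz

theorem hull_pos {ρ a b : ℝ} {A : Set Plane} (h : ∀ p ∈ A, 0 < HH ρ a b p) {z : Plane}
    (hz : z ∈ convexHull ℝ A) : 0 < HH ρ a b z := by
  have hc : Convex ℝ {p | 0 < HH ρ a b p} := by
    intro p hp q hq u v hu hv huv
    simp only [Set.mem_setOf_eq] at *
    rw [HH_comb _ _ _ _ _ _ _ huv]
    rcases hu.eq_or_lt with rfl | hu'
    · have : v = 1 := by linarith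
      subst this; linarith
    · nlinarith
  exact convexHull_min h hc hz

theorem hull_finite {A : Set Plane} {z : Plane} (hz : z ∈ convexHull ℝ A) :
    ∃ W : Set Plane, W.Finite ∧ z ∈ convexHull ℝ (A ∩ W) := by
  rw [convexHull_eq_union_convexHull_finite_subsets] at hz
  simp only [Set.mem_iUnion] at hz
  obtain ⟨t, ht, hz⟩ := hz
  have hsub : (t : Set Plane) ⊆ A ∩ t := fun x hx => ⟨ht hx, hx⟩
  exact ⟨t, t.finite_toSet, convexHull_mono hsub hz⟩

theorem tight_mono {A B C A' B' C' : Set Plane} (h : Tight A B C) (hA : A ⊆ A') (hB : B ⊆ B')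
    (hC : C ⊆ C') : Tight A' B' C' := by
  obtain ⟨z, ⟨h1, h2⟩, h3⟩ := h
  exact ⟨z, ⟨convexHull_mono (Set.union_subset_union hA hB) h1,
    convexHull_mono (Set.union_subset_union hA hC) h2⟩,
    convexHull_mono (Set.union_subset_union hB hC) h3⟩

theorem tight_finite {A B C : Set Plane} (h : Tight A B C) :
    ∃ W : Set Plane, W.Finite ∧ Tight (A ∩ W) (B ∩ W) (C ∩ W) := by
  obtain ⟨z, ⟨h1, h2⟩, h3⟩ := h
  obtain ⟨W1, f1, h1⟩ := hull_finite h1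
  obtain ⟨W2, f2, h2⟩ := hull_finite h2
  obtain ⟨W3, f3, h3⟩ := hull_finite h3
  refine ⟨W1 ∪ W2 ∪ W3, (f1.union f2).union f3, z, ⟨?_, ?_⟩, ?_⟩
  · refine convexHull_mono ?_ h1
    rw [Set.union_inter_distrib_right]
    gcongr <;> intro w hw <;> simp [hw]
  · refine convexHull_mono ?_ h2
    rw [Set.union_inter_distrib_right]
    gcongr <;> intro w hw <;> simp [hw]
  · refine convexHull_mono ?_ h3
    rw [Set.union_inter_distrib_right]
    gcongr <;> intro w hw <;> simp [hw]

theorem exists_W (F : Set (Set Plane)) (hfin : F.Finite)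
    (htight : ∀ A ∈ F, ∀ B ∈ F, ∀ C ∈ F, Tight A B C) :
    ∃ W : Set Plane, W.Finite ∧ ∀ A ∈ F, ∀ B ∈ F, ∀ C ∈ F, Tight (A ∩ W) (B ∩ W) (C ∩ W) := by
  have h : ∀ A B C : Set Plane, ∃ W : Set Plane, W.Finite ∧
      (A ∈ F → B ∈ F → C ∈ F → Tight (A ∩ W) (B ∩ W) (C ∩ W)) := by
    intro A B C
    by_cases h : A ∈ F ∧ B ∈ F ∧ C ∈ F
    · obtain ⟨W, hW, hW'⟩ := tight_finite (htight A h.1 B h.2.1 C h.2.2)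
      exact ⟨W, hW, fun _ _ _ => hW'⟩
    · exact ⟨∅, Set.finite_empty, fun a b c => absurd ⟨a, b, c⟩ h⟩
  choose W hW hW' using h
  refine ⟨⋃ A ∈ F, ⋃ B ∈ F, ⋃ C ∈ F, W A B C, ?_, ?_⟩
  · exact hfin.biUnion fun A _ => hfin.biUnion fun B _ => hfin.biUnion fun C _ => hW A B C
  · intro A hA B hB C hC
    have hsub : W A B C ⊆ ⋃ A ∈ F, ⋃ B ∈ F, ⋃ C ∈ F, W A B C := by
      intro w hw
      simp only [Set.mem_iUnion]
      exact ⟨A, hA, B, hB, C, hC, hw⟩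
    exact tight_mono (hW' A B C hA hB hC) (Set.inter_subset_inter_right _ hsub)
      (Set.inter_subset_inter_right _ hsub) (Set.inter_subset_inter_right _ hsub)

theorem stmt_13 (F : Set (Set Plane)) (hfin : F.Finite)
    (hne : ∀ S ∈ F, S.Nonempty)
    (hconn : ∀ S ∈ F, IsConnected S)
    (htight : ∀ A ∈ F, ∀ B ∈ F, ∀ C ∈ F, Tight A B C) :
    PiercedByLines F 3 := by
  obtain ⟨W, hWfin, hW⟩ := exists_W F hfin htight
  obtain ⟨ρ, hρ, hWρ⟩ : ∃ ρ : ℝ, 0 < ρ ∧ ∀ p ∈ W, ‖p‖ < ρ := by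
    obtain ⟨ρ, hρ, h⟩ := hWfin.isBounded.exists_pos_norm_lt
    exact ⟨ρ, hρ, h⟩
  have hSW : ∀ S ∈ F, (S ∩ W).Nonempty := by
    intro S hS
    obtain ⟨z, ⟨h1, -⟩, -⟩ := hW S hS S hS S hS
    rw [Set.union_self] at h1
    exact convexHull_nonempty_iff.1 ⟨z, h1⟩
  have hull_norm : ∀ A : Set Plane, A ⊆ W → ∀ z ∈ convexHull ℝ A, ‖z‖ < ρ := by
    intro A hA z hz
    have : convexHull ℝ A ⊆ Metric.ball 0 ρ :=
      convexHull_min (fun p hp => by simpa using hWρ p (hA hp)) (convex_ball 0 ρ)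
    simpa using this hz
  let A : Fin 6 → Set (Fin 6 → ℝ) := fun i => ⋃ S ∈ F, ⋂ p ∈ S ∩ W, {x | condi ρ x p i}
  have hAmem : ∀ i x, x ∈ A i ↔ ∃ S ∈ F, ∀ p ∈ S ∩ W, condi ρ x p i := by
    intro i x
    simp only [A, Set.mem_iUnion, Set.mem_iInter, Set.mem_setOf_eq, exists_prop]
  have hAopen : ∀ i, IsOpen (A i) := by
    intro i
    exact isOpen_biUnion fun S _ => (hWfin.subset Set.inter_subset_right).isOpen_biInter
      fun p _ => cond_open ρ p i
  obtain ⟨x, hx, hxB⟩ : ∃ x ∈ stdSimplex ℝ (Fin 6), ∀ i, x ∈ (A i)ᶜ := by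
    apply kkm (fun i => (A i)ᶜ) (fun i => (hAopen i).isClosed_compl)
    · intro x hx
      by_contra! hcon
      have hall : ∀ i, ∃ S ∈ F, ∀ p ∈ S ∩ W, condi ρ x p i := by
        intro i
        have := hcon i
        rw [Set.mem_compl_iff, not_not, hAmem] at this
        exact this
      obtain ⟨S0, m0, h0⟩ := hall 0
      obtain ⟨S1, m1, h1⟩ := hall 1
      obtain ⟨S2, m2, h2⟩ := hall 2
      obtain ⟨S3, m3, h3⟩ := hall 3
      obtain ⟨S4, m4, h4⟩ := hall 4
      obtain ⟨S5, m5, h5⟩ := hall 5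
      replace h0 : ∀ p ∈ S0 ∩ W, D0 ρ x p < 0 ∧ 0 < D1 ρ x p := h0
      replace h1 : ∀ p ∈ S1 ∩ W, D1 ρ x p < 0 ∧ 0 < D2 ρ x p := h1
      replace h2 : ∀ p ∈ S2 ∩ W, D0 ρ x p < 0 ∧ D2 ρ x p < 0 := h2
      replace h3 : ∀ p ∈ S3 ∩ W, 0 < D0 ρ x p ∧ D1 ρ x p < 0 := h3
      replace h4 : ∀ p ∈ S4 ∩ W, 0 < D1 ρ x p ∧ D2 ρ x p < 0 := h4
      replace h5 : ∀ p ∈ S5 ∩ W, 0 < D0 ρ x p ∧ 0 < D2 ρ x p := h5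
      obtain ⟨q, ⟨q1, q2⟩, q3⟩ := hW S0 m0 S2 m2 S4 m4
      obtain ⟨p, ⟨p1, p2⟩, p3⟩ := hW S1 m1 S3 m3 S5 m5
      refine no_both_s13 (p := p) (q := q) hρ hx
        (hull_norm _ (Set.union_subset Set.inter_subset_right Set.inter_subset_right) p p1)
        (hull_pos ?_ p3) (hull_neg ?_ p1) (hull_pos ?_ p2) (hull_neg ?_ q1) (hull_pos ?_ q2)
        (hull_neg ?_ q3)
      · rintro w (hw | hw)
        exacts [(h3 w hw).1, (h5 w hw).1]
      · rintro w (hw | hw)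
        exacts [(h1 w hw).1, (h3 w hw).2]
      · rintro w (hw | hw)
        exacts [(h1 w hw).2, (h5 w hw).2]
      · rintro w (hw | hw)
        exacts [(h0 w hw).1, (h2 w hw).1]
      · rintro w (hw | hw)
        exacts [(h0 w hw).2, (h4 w hw).1]
      · rintro w (hw | hw)
        exacts [(h2 w hw).2, (h4 w hw).2]
    · intro x hx i hi
      rw [Set.mem_compl_iff, hAmem]
      rintro ⟨S, hS, h⟩
      obtain ⟨p, hp⟩ := hSW S hS
      exact cond_bd hρ hx (hWρ p hp.2) hi (h p hp)
  refine ⟨![{p | D0 ρ x p = 0}, {p | D1 ρ x p = 0}, {p | D2 ρ x p = 0}], ?_, ?_⟩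
  · intro i
    fin_cases i
    · exact isLine_HH _ _ _
    · exact isLine_HH _ _ _
    · exact isLine_HH _ _ _
  · intro S hS
    by_contra hcon
    rw [Set.not_nonempty_iff_eq_empty] at hcon
    have hno : ∀ p ∈ S, D0 ρ x p ≠ 0 ∧ D1 ρ x p ≠ 0 ∧ D2 ρ x p ≠ 0 := by
      intro p hp
      have : p ∉ ⋃ i, (![{p | D0 ρ x p = 0}, {p | D1 ρ x p = 0}, {p | D2 ρ x p = 0}] :
          Fin 3 → Set Plane) i := by
        intro h
        exact (Set.mem_empty_iff_false p).1 (hcon ▸ ⟨hp, h⟩)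
      simp only [Set.mem_iUnion, not_exists] at this
      exact ⟨this 0, this 1, this 2⟩
    have hpre := (hconn S hS).isPreconnected
    have hA : ∀ i, ¬ ∀ p ∈ S ∩ W, condi ρ x p i := by
      intro i h
      exact hxB i ((hAmem i x).2 ⟨S, hS, h⟩)
    rcases HH_sign _ _ _ S hpre (fun p hp => (hno p hp).1) with s0 | s0 <;>
    rcases HH_sign _ _ _ S hpre (fun p hp => (hno p hp).2.1) with s1 | s1 <;>
    rcases HH_sign _ _ _ S hpre (fun p hp => (hno p hp).2.2) with s2 | s2
    · exact hA 5 fun p hp => ⟨s0 p hp.1, s2 p hp.1⟩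
    · exact hA 4 fun p hp => ⟨s1 p hp.1, s2 p hp.1⟩
    · exact hA 5 fun p hp => ⟨s0 p hp.1, s2 p hp.1⟩
    · exact hA 3 fun p hp => ⟨s0 p hp.1, s1 p hp.1⟩
    · exact hA 0 fun p hp => ⟨s0 p hp.1, s1 p hp.1⟩
    · exact hA 0 fun p hp => ⟨s0 p hp.1, s1 p hp.1⟩
    · exact hA 1 fun p hp => ⟨s1 p hp.1, s2 p hp.1⟩
    · exact hA 2 fun p hp => ⟨s0 p hp.1, s2 p hp.1⟩
end
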